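/- arXiv:2311.06489 — 4 statements merged into one kernel-verified Lean document; each statement's English description precedes it below -/
import Mathlib

section
/- Let q ≥ 1 and for j = 1,…,n let χ_j be a primitive Dirichlet character modulo q; set χ((a_1,…,a_n)) = ∏_{j=1}^n χ_j(a_j) for a ∈ ℤ^n. Let Γ = ℤ^n A with A ∈ GL_n(ℝ) be a sublattice of ℤ^n such that every entry of A is divisible by q. Then for all (t_1,…,t_n) ∈ ℂ^n, x = (x_1,…,x_n) ∈ ℤ^n and y = (y_1,…,y_n) ∈ ℝ^n: Σ_{γ=(γ_j)∈Γ} χ(γA^{-1}) (∏_{j=1}^n I_{x_j+γ_j/q}(t_j)) e^{2πi⟨y, x+γ/q⟩} = (∏_{j=1}^n G(χ_j) / vol(ℝ^n/Γ)) · Σ_{γ*=(γ*_j)∈Γ*} \bar{χ}(γ* ᵗA) (∏_{j=1}^n 1_{[-1/2,1/2]}(y_j−γ*_j) e^{t_j cos 2π(y_j−γ*_j)}) e^{2πi⟨x, γ*⟩}. -/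
open scoped Real
open Complex Matrix

/-- The modified Bessel function of the first kind with integer order,
`I_x(t) = (1/π) ∫₀^π e^{t cos θ} cos(xθ) dθ`. -/
noncomputable def besselI (x : ℝ) (t : ℂ) : ℂ :=
  (Real.pi : ℂ)⁻¹ * ∫ θ in (0:ℝ)..Real.pi, Complex.exp (t * Real.cos θ) * (Real.cos (x * θ) : ℂ)

/-- The rectangular function `1_{[-1/2,1/2]}`. -/
noncomputable def rect (x : ℝ) : ℝ :=
  if |x| < 1/2 then 1 else if |x| = 1/2 then 1/2 else 0

/-- The Gauss sum `G(χ) = Σ_{a=0}^{q−1} χ(a) e^{2πi a/q}` of a Dirichlet character mod `q`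
(for `q = 1`, this one-term sum equals `1`). -/
noncomputable def gaussSumChar {q : ℕ} (χ : DirichletCharacter ℂ q) : ℂ :=
  ∑ a ∈ Finset.range q, χ (a : ZMod q) * Complex.exp (2 * Real.pi * I * (a : ℝ) / (q : ℝ))

theorem hasSum_prod_pi_int {n : ℕ} {g : Fin n → ℤ → ℂ} {s : Fin n → ℂ}
    (h : ∀ j, HasSum (g j) (s j)) :
    HasSum (fun z : Fin n → ℤ => ∏ j, g j (z j)) (∏ j, s j) := by
  induction n with
  | zero => simp
  | succ n ih =>
    have ht := ih (fun j => h j.succ)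
    have hs : Summable fun p : ℤ × (Fin n → ℤ) => g 0 p.1 * ∏ j : Fin n, g j.succ (p.2 j) := by
      have := summable_mul_of_summable_norm (h 0).summable.norm ht.summable.norm
      exact this
    have hp : HasSum (fun p : ℤ × (Fin n → ℤ) => g 0 p.1 * ∏ j : Fin n, g j.succ (p.2 j))
        (s 0 * ∏ j : Fin n, s j.succ) := by
      have := (h 0).mul ht hs
      exact this
    rw [Fin.prod_univ_succ, ← (Fin.consEquiv fun _ => ℤ).hasSum_iff]
    refine hp.congr_fun ?_
    intro p
    simp [Fin.prod_univ_succ, Fin.consEquiv]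

theorem hasSum_rect_sub_int (u : ℝ) : HasSum (fun a : ℤ => (rect (u - a) : ℂ)) 1 := by
  obtain ⟨a₀, ha₀⟩ : ∃ a₀ : ℤ, a₀ = ⌊u + 1 / 2⌋ := ⟨_, rfl⟩
  have h1 : (a₀ : ℝ) ≤ u + 1 / 2 := ha₀ ▸ Int.floor_le _
  have h2 : u + 1 / 2 < a₀ + 1 := ha₀ ▸ Int.lt_floor_add_one _
  have hval : ∑ a ∈ ({a₀, a₀ - 1} : Finset ℤ), (rect (u - a) : ℂ) = 1 := by
    rw [Finset.sum_pair (by omega)]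
    norm_cast
    push_cast
    unfold rect
    rcases eq_or_lt_of_le h1 with h | h
    · have e1 : u - a₀ = -(1 / 2) := by linarith
      have e2 : u - (a₀ - 1) = 1 / 2 := by linarith
      rw [e1, e2]
      norm_num [abs_of_pos]
    · have e1 : |u - a₀| < 1 / 2 := abs_lt.2 ⟨by linarith, by linarith⟩
      have e2 : 1 / 2 < |u - (a₀ - 1)| := lt_abs.2 (Or.inl (by linarith))
      rw [if_pos e1, if_neg e2.not_gt, if_neg e2.ne', add_zero]
  rw [← hval]
  refine hasSum_sum_of_ne_finset_zero fun a ha => ?_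
  have e : 1 / 2 < |u - a| := by
    simp only [Finset.mem_insert, Finset.mem_singleton, not_or] at ha
    rcases lt_or_gt_of_ne ha.1 with h | h
    · have : a ≤ a₀ - 2 := by omega
      have : (a : ℝ) ≤ a₀ - 2 := by exact_mod_cast this
      exact lt_abs.2 (Or.inl (by linarith))
    · have : a₀ + 1 ≤ a := by omega
      have : (a₀ : ℝ) + 1 ≤ a := by exact_mod_cast this
      exact lt_abs.2 (Or.inr (by linarith))
  rw [rect, if_neg e.not_gt, if_neg e.ne', Complex.ofReal_zero]

theorem fourierCoeffOn_unit_eq_integral (f : ℝ → ℂ) (n : ℤ) :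
    fourierCoeffOn (zero_lt_one' ℝ) f n =
      ∫ x in (0 : ℝ)..1, Complex.exp (-(2 * π * I * n * x)) * f x := by
  rw [fourierCoeffOn_eq_integral]
  simp only [fourier_coe_apply, sub_zero, div_one, one_smul, smul_eq_mul]
  refine intervalIntegral.integral_congr fun x _ => ?_
  congr 2
  push_cast
  ring

theorem norm_fourierCoeffOn_unit_le {f : ℝ → ℂ} {C : ℝ} (hC : ∀ x, ‖f x‖ ≤ C) (n : ℤ) :
    ‖fourierCoeffOn (zero_lt_one' ℝ) f n‖ ≤ C := by
  rw [fourierCoeffOn_unit_eq_integral]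
  refine (intervalIntegral.norm_integral_le_of_norm_le_const (C := C) fun x _ => ?_).trans
    (by simp)
  have : -(2 * π * I * n * x) = ((-(2 * π * n * x) : ℝ) : ℂ) * I := by push_cast; ring
  rw [norm_mul, this, Complex.norm_exp_ofReal_mul_I, one_mul]
  exact hC x

theorem fourierCoeffOn_unit_of_hasDerivAt {f f' : ℝ → ℂ} (hf : ∀ x, HasDerivAt f (f' x) x)
    (hf' : Continuous f') (h01 : f 1 = f 0) {n : ℤ} (hn : n ≠ 0) :
    fourierCoeffOn (zero_lt_one' ℝ) f n =
      fourierCoeffOn (zero_lt_one' ℝ) f' n / (2 * π * I * n) := by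
  rw [fourierCoeffOn_of_hasDerivAt _ hn (fun x _ => hf x) (hf'.intervalIntegrable _ _), h01]
  have : (n : ℂ) ≠ 0 := by exact_mod_cast hn
  simp only [sub_self, mul_zero, zero_sub, ofReal_one, ofReal_zero, sub_zero, one_mul]
  field_simp

theorem summable_fourierCoeffOn_unit {f f' f'' : ℝ → ℂ} (hf : ∀ x, HasDerivAt f (f' x) x)
    (hf' : ∀ x, HasDerivAt f' (f'' x) x) (hf'' : Continuous f'') (h01 : f 1 = f 0)
    (h01' : f' 1 = f' 0) (hper : Function.Periodic f'' 1) :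
    Summable (fourierCoeffOn (zero_lt_one' ℝ) f) := by
  obtain ⟨C, hC⟩ : ∃ C, ∀ x, ‖f'' x‖ ≤ C := by
    obtain ⟨C, hC⟩ := hper.isBounded_of_continuous one_ne_zero hf'' |>.exists_norm_le
    exact ⟨C, fun x => hC _ ⟨x, rfl⟩⟩
  have hc' : Continuous f' := continuous_iff_continuousAt.2 fun x => (hf' x).continuousAt
  refine Summable.of_norm_bounded_eventually
    (g := fun n : ℤ => C / (4 * π ^ 2) * (1 / (n : ℝ) ^ 2))
    ((Real.summable_one_div_int_pow.2 one_lt_two).mul_left _) ?_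
  rw [Filter.eventually_cofinite]
  refine (Set.finite_singleton (0 : ℤ)).subset fun n hn => ?_
  by_contra h0
  refine hn ?_
  rw [fourierCoeffOn_unit_of_hasDerivAt hf hc' h01 h0,
    fourierCoeffOn_unit_of_hasDerivAt hf' hf'' h01' h0, div_div, norm_div]
  have h1 : ‖(2 * π * I * n) * (2 * π * I * n : ℂ)‖ = 4 * π ^ 2 * (n : ℝ) ^ 2 := by
    rw [norm_mul]
    simp only [norm_mul, Complex.norm_ofNat, Complex.norm_real, Complex.norm_I, Complex.norm_intCast,
      Real.norm_eq_abs, abs_of_pos Real.pi_pos]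
    rw [← sq_abs (n : ℝ)]
    ring
  have h2 : 0 < (n : ℝ) ^ 2 := by
    have : (n : ℝ) ≠ 0 := by exact_mod_cast h0
    positivity
  rw [h1, div_mul_div_comm, mul_one]
  gcongr
  exact norm_fourierCoeffOn_unit_le hC n

theorem besselI_eq_fourierCoeffOn (t : ℂ) (n : ℤ) :
    besselI n t = fourierCoeffOn (zero_lt_one' ℝ)
      (fun x : ℝ => Complex.exp (t * Real.cos (2 * π * x))) n := by
  rw [fourierCoeffOn_unit_eq_integral]
  set g : ℝ → ℂ := fun x =>
    Complex.exp (-(2 * π * I * n * x)) * Complex.exp (t * Real.cos (2 * π * x)) with hg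
  have hgc : Continuous g := by fun_prop
  have hper : Function.Periodic g 1 := by
    intro x
    simp only [hg]
    have h1 : Complex.exp (-(2 * π * I * n * (x + 1 : ℝ))) =
        Complex.exp (-(2 * π * I * n * x)) := by
      rw [Complex.exp_eq_exp_iff_exists_int]
      exact ⟨-n, by push_cast; ring⟩
    have h2 : Real.cos (2 * π * (x + 1)) = Real.cos (2 * π * x) := by
      rw [mul_add, mul_one, Real.cos_add_two_pi]
    rw [h1, h2]
  have hshift : ∫ x in (0 : ℝ)..1, g x = ∫ x in (-(1 / 2) : ℝ)..(1 / 2), g x := by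
    have := hper.intervalIntegral_add_eq 0 (-(1 / 2))
    rw [zero_add] at this
    rw [this]
    norm_num
  have hneg : ∫ x in (-(1 / 2) : ℝ)..0, g x = ∫ x in (0 : ℝ)..(1 / 2), g (-x) := by
    rw [intervalIntegral.integral_comp_neg, neg_zero]
  have hsub : ∫ x in (0 : ℝ)..(1 / 2), Complex.exp (t * Real.cos (2 * π * x)) *
      (Real.cos (n * (2 * π * x)) : ℂ) = (2 * π)⁻¹ *
      ∫ θ in (0 : ℝ)..π, Complex.exp (t * Real.cos θ) * (Real.cos (n * θ) : ℂ) := by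
    have := intervalIntegral.integral_comp_mul_left (a := 0) (b := 1 / 2)
      (fun θ : ℝ => Complex.exp (t * Real.cos θ) * (Real.cos (n * θ) : ℂ))
      (c := 2 * π) (by positivity)
    rw [this, mul_zero, show 2 * π * (1 / 2) = π by ring, Complex.real_smul]
  rw [hshift, ← intervalIntegral.integral_add_adjacent_intervals (b := 0)
    (hgc.intervalIntegrable _ _) (hgc.intervalIntegrable _ _), hneg,
    ← intervalIntegral.integral_add ((show Continuous fun x => g (-x) from hgc.comp continuous_neg).intervalIntegrable _ _)
    (hgc.intervalIntegrable _ _), besselI]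
  have hcongr : ∫ x in (0 : ℝ)..(1 / 2), (g (-x) + g x) =
      ∫ x in (0 : ℝ)..(1 / 2), 2 * (Complex.exp (t * Real.cos (2 * π * x)) *
      (Real.cos (n * (2 * π * x)) : ℂ)) := by
    refine intervalIntegral.integral_congr fun x _ => ?_
    simp only [hg, mul_neg, Real.cos_neg, Complex.ofReal_neg, neg_neg]
    rw [Complex.ofReal_cos (n * _), Complex.cos]
    push_cast
    rw [show (2 * π * I * n * x : ℂ) = n * (2 * π * x) * I by ring,
      show (-(n * (2 * π * x) * I) : ℂ) = -(n * (2 * π * x)) * I by ring]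
    ring
  rw [hcongr, intervalIntegral.integral_const_mul, hsub, ← mul_assoc]
  congr 1
  push_cast
  field_simp

theorem summable_besselI (t : ℂ) : Summable fun n : ℤ => besselI n t := by
  simp_rw [besselI_eq_fourierCoeffOn]
  have hlin : ∀ x : ℝ, HasDerivAt (fun x : ℝ => 2 * π * x) (2 * π) x := fun x => by
    simpa using (hasDerivAt_id x).const_mul (2 * π)
  have hcos : ∀ x : ℝ, HasDerivAt (fun x : ℝ => t * ((Real.cos (2 * π * x) : ℝ) : ℂ))
      (t * ((-Real.sin (2 * π * x) * (2 * π) : ℝ) : ℂ)) x := fun x =>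
    ((hlin x).cos.ofReal_comp).const_mul t
  have hsin : ∀ x : ℝ, HasDerivAt (fun x : ℝ => t * ((-Real.sin (2 * π * x) * (2 * π) : ℝ) : ℂ))
      (t * ((-(Real.cos (2 * π * x) * (2 * π)) * (2 * π) : ℝ) : ℂ)) x := fun x =>
    (((hlin x).sin.neg.mul_const (2 * π)).ofReal_comp).const_mul t
  refine summable_fourierCoeffOn_unit (fun x => (hcos x).cexp)
    (fun x => (hcos x).cexp.mul (hsin x)) (by fun_prop) (by simp) (by simp) fun x => ?_
  have h1 : Real.cos (2 * π * (x + 1)) = Real.cos (2 * π * x) := by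
    rw [mul_add, mul_one, Real.cos_add_two_pi]
  have h2 : Real.sin (2 * π * (x + 1)) = Real.sin (2 * π * x) := by
    rw [mul_add, mul_one, Real.sin_add_two_pi]
  simp only [h1, h2]

theorem hasSum_besselI_mul_exp (t : ℂ) (y : ℝ) :
    HasSum (fun n : ℤ => besselI n t * Complex.exp (2 * π * I * (y * n)))
      (Complex.exp (t * Real.cos (2 * π * y))) := by
  have hper : Function.Periodic (fun x : ℝ => Complex.exp (t * Real.cos (2 * π * x))) 1 := by
    intro x
    simp only
    rw [mul_add, mul_one, Real.cos_add_two_pi]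
  let f : C(AddCircle (1 : ℝ), ℂ) :=
    ⟨hper.lift, (QuotientAddGroup.isQuotientMap_mk (N := AddSubgroup.zmultiples (1 : ℝ))).continuous_iff.2
      (show Continuous fun x : ℝ => Complex.exp (t * Real.cos (2 * π * x)) by fun_prop)⟩
  have hcoeff : ∀ n : ℤ, fourierCoeff f n = besselI n t := by
    intro n
    rw [besselI_eq_fourierCoeffOn, fourierCoeffOn_unit_eq_integral,
      fourierCoeff_eq_intervalIntegral _ _ 0]
    simp only [fourier_coe_apply, zero_add, div_one, one_smul, smul_eq_mul]
    refine intervalIntegral.integral_congr fun x _ => ?_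
    have : f (x : AddCircle (1 : ℝ)) = Complex.exp (t * Real.cos (2 * π * x)) := rfl
    simp only [this]
    congr 2
    push_cast
    ring
  have := has_pointwise_sum_fourier_series_of_summable (f := f)
    ((summable_besselI t).congr fun n => (hcoeff n).symm) (y : AddCircle (1 : ℝ))
  refine this.congr_fun fun n => ?_
  rw [hcoeff, fourier_coe_apply, smul_eq_mul]
  congr 2
  push_cast
  ring

/-- The additive character `r ↦ e^{2πir}` of `ℝ`. -/
noncomputable def expTwoPiI (r : ℝ) : ℂ := Complex.exp (2 * π * I * r)

theorem expTwoPiI_add (r s : ℝ) : expTwoPiI (r + s) = expTwoPiI r * expTwoPiI s := by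
  rw [expTwoPiI, expTwoPiI, expTwoPiI, ← Complex.exp_add]
  push_cast
  ring_nf

theorem expTwoPiI_sum {ι : Type*} (s : Finset ι) (f : ι → ℝ) :
    expTwoPiI (∑ i ∈ s, f i) = ∏ i ∈ s, expTwoPiI (f i) := by
  simp only [expTwoPiI, Complex.ofReal_sum, Finset.mul_sum, Complex.exp_sum]

theorem expTwoPiI_eq_one_iff (r : ℝ) : expTwoPiI r = 1 ↔ ∃ k : ℤ, r = k := by
  rw [expTwoPiI, Complex.exp_eq_one_iff]
  have h : (2 * π * I : ℂ) ≠ 0 := Complex.two_pi_I_ne_zero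
  refine exists_congr fun k => ?_
  rw [mul_comm (k : ℂ), mul_right_inj' h]
  norm_cast

theorem stdAddChar_intCast_eq_expTwoPiI {q : ℕ} [NeZero q] (a : ℤ) :
    ZMod.stdAddChar (a : ZMod q) = expTwoPiI (a / q) := by
  rw [ZMod.stdAddChar_coe, expTwoPiI]
  push_cast
  ring_nf

theorem gaussSumChar_eq_gaussSum {q : ℕ} [NeZero q] (χ : DirichletCharacter ℂ q) :
    gaussSumChar χ = gaussSum χ ZMod.stdAddChar := by
  rw [gaussSumChar, gaussSum]
  refine Finset.sum_bij' (fun a _ => (a : ZMod q)) (fun b _ => b.val) (by simp)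
    (fun b _ => Finset.mem_range.2 b.val_lt)
    (fun a ha => ZMod.val_cast_of_lt (Finset.mem_range.1 ha)) (fun b _ => ZMod.natCast_zmod_val b)
    fun a _ => ?_
  have := ZMod.stdAddChar_coe (N := q) (a : ℤ)
  push_cast at this ⊢
  rw [this]

theorem gaussSumChar_mul_sum_inv_mul_stdAddChar {q : ℕ} [NeZero q] {χ : DirichletCharacter ℂ q}
    (hχ : χ.IsPrimitive) (k : ZMod q) :
    gaussSumChar χ * ∑ v : ZMod q, χ⁻¹ v * ZMod.stdAddChar (-(v * k)) = q * χ k := by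
  have h := congrFun (ZMod.dft_dft (χ : ZMod q → ℂ)) (-k)
  rw [ZMod.dft_apply] at h
  simp only [hχ.fourierTransform_eq_inv_mul_gaussSum, neg_neg, smul_eq_mul] at h
  rw [← h, gaussSumChar_eq_gaussSum, Finset.mul_sum, ← Equiv.sum_comp (Equiv.neg (ZMod q))]
  refine Finset.sum_congr rfl fun v _ => ?_
  simp only [Equiv.neg_apply, mul_neg, neg_mul, neg_neg]
  ring

theorem card_mul_sum_comp_of_surjective {G Q : Type*} [AddCommGroup G] [AddCommGroup Q] [Fintype G]
    [Fintype Q] (f : G →+ Q) (hf : Function.Surjective f) (u : Q → ℂ) :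
    (Fintype.card Q : ℂ) * ∑ g, u (f g) = Fintype.card G * ∑ v, u v := by
  have h1 : ∑ g, ∑ v, u (f g + v) = Fintype.card G * ∑ v, u v := by
    refine (Finset.sum_congr rfl fun g _ => Equiv.sum_comp (Equiv.addLeft (f g)) u).trans ?_
    simp
  have h2 : ∑ v, ∑ g, u (f g + v) = Fintype.card Q * ∑ g, u (f g) := by
    have : ∀ v, ∑ g, u (f g + v) = ∑ g, u (f g) := by
      intro v
      obtain ⟨g₀, rfl⟩ := hf v
      simp only [← map_add]
      exact Equiv.sum_comp (Equiv.addRight g₀) fun g => u (f g)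
    simp [this]
  rw [← h2, ← h1, Finset.sum_comm]

theorem sum_eq_zero_of_add_right_eq_mul {G : Type*} [AddCommGroup G] [Fintype G] {f : G → ℂ}
    {ζ : ℂ} (hζ : ζ ≠ 1) (g₀ : G) (h : ∀ g, f (g + g₀) = ζ * f g) : ∑ g, f g = 0 := by
  have : ∑ g, f g = ζ * ∑ g, f g := by
    rw [Finset.mul_sum, ← Equiv.sum_comp (Equiv.addRight g₀) f]
    exact Finset.sum_congr rfl fun g _ => h g
  have h0 : (1 - ζ) * ∑ g, f g = 0 := by rw [sub_mul, one_mul, ← this, sub_self]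
  exact (mul_eq_zero.1 h0).resolve_left (sub_ne_zero.2 hζ.symm)

theorem natCard_quotient_range_mulVecLin {n : ℕ} {M : Matrix (Fin n) (Fin n) ℤ} (hM : M.det ≠ 0) :
    Nat.card ((Fin n → ℤ) ⧸ LinearMap.range M.mulVecLin) = M.det.natAbs := by
  have hinj : Function.Injective M.mulVecLin := Matrix.mulVec_injective_of_det_ne_zero hM
  rw [← Submodule.natAbs_det_equiv _ (LinearEquiv.ofInjective M.mulVecLin hinj)]
  congr 1
  rw [← LinearMap.det_toLin' M]
  congr 1

theorem hasSum_mul_of_periodic {G G' : Type*} [AddCommGroup G] [AddCommGroup G']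
    {φ : G' →ₗ[ℤ] G} (hφ : Function.Injective φ) [Fintype (G ⧸ LinearMap.range φ)]
    (h : G ⧸ LinearMap.range φ → ℂ) {w : G → ℂ} (hw : ∀ m, HasSum (fun a => w (m + φ a)) 1) :
    HasSum (fun m => h (Submodule.Quotient.mk m) * w m) (∑ c, h c) := by
  classical
  have key : ∀ c, HasSum (fun m : G => if Submodule.Quotient.mk m = c then h c * w m else 0)
      (h c) := by
    intro c
    obtain ⟨m₀, rfl⟩ := Submodule.Quotient.mk_surjective _ c
    have hinj : Function.Injective fun a => m₀ + φ a := (add_right_injective m₀).comp hφ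
    rw [← hinj.hasSum_iff]
    · have := (hw m₀).mul_left (h (Submodule.Quotient.mk m₀))
      rw [mul_one] at this
      refine this.congr_fun fun a => ?_
      have : (Submodule.Quotient.mk (m₀ + φ a) : G ⧸ LinearMap.range φ) =
          Submodule.Quotient.mk m₀ := by
        rw [Submodule.Quotient.eq]
        simp
      simp only [Function.comp_apply, if_pos this]
    · intro m hm
      refine if_neg fun hmc => hm ?_
      obtain ⟨a, ha⟩ := (Submodule.Quotient.eq _).1 hmc
      exact ⟨a, by simp [ha]⟩
  refine (hasSum_sum fun c (_ : c ∈ Finset.univ) => key c).congr_fun fun m => ?_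
  simp

theorem dual_add {n : ℕ} (A : Matrix (Fin n) (Fin n) ℝ) (m m' : Fin n → ℤ) :
    (fun i => ((m + m') i : ℝ)) ᵥ* (Aᵀ)⁻¹ =
      (fun i => (m i : ℝ)) ᵥ* (Aᵀ)⁻¹ + (fun i => (m' i : ℝ)) ᵥ* (Aᵀ)⁻¹ := by
  rw [← Matrix.add_vecMul]
  congr 1
  ext i
  simp

theorem dual_mulVec {n : ℕ} {A : Matrix (Fin n) (Fin n) ℝ} (hA : IsUnit A.det)
    {M : Matrix (Fin n) (Fin n) ℤ} (hM : ∀ i j, A i j = M i j) (a : Fin n → ℤ) :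
    (fun i => ((M *ᵥ a) i : ℝ)) ᵥ* (Aᵀ)⁻¹ = fun i => (a i : ℝ) := by
  have h : (fun i => ((M *ᵥ a) i : ℝ)) = (fun i => (a i : ℝ)) ᵥ* Aᵀ := by
    ext i
    simp [Matrix.mulVec, Matrix.vecMul_transpose, dotProduct, hM]
  rw [h, Matrix.vecMul_vecMul, Matrix.mul_nonsing_inv _ (by rwa [Matrix.det_transpose]),
    Matrix.vecMul_one]

theorem dual_dotProduct_vecMul {n q : ℕ} [NeZero q] {A : Matrix (Fin n) (Fin n) ℝ}
    (hA : IsUnit A.det) {N : Matrix (Fin n) (Fin n) ℤ} (hN : ∀ i j, A i j = (q : ℝ) * N i j)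
    (m k : Fin n → ℤ) :
    ((fun i => (m i : ℝ)) ᵥ* (Aᵀ)⁻¹) ⬝ᵥ (fun i => ((k ᵥ* N) i : ℝ)) =
      ∑ j, ((m j * k j : ℤ) : ℝ) / q := by
  have hq : (q : ℝ) ≠ 0 := NeZero.ne _
  have h : (fun i => ((k ᵥ* N) i : ℝ)) = (q : ℝ)⁻¹ • (Aᵀ *ᵥ fun i => (k i : ℝ)) := by
    ext i
    simp only [Matrix.vecMul, dotProduct, Matrix.mulVec, hN, Pi.smul_apply, smul_eq_mul,
      Finset.mul_sum, Matrix.transpose_apply, Int.cast_sum, Int.cast_mul]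
    refine Finset.sum_congr rfl fun j _ => ?_
    field_simp
  rw [h, ← Matrix.dotProduct_mulVec, Matrix.mulVec_smul, Matrix.mulVec_mulVec,
    Matrix.nonsing_inv_mul _ (by rwa [Matrix.det_transpose]), Matrix.one_mulVec, dotProduct]
  refine Finset.sum_congr rfl fun j _ => ?_
  simp only [Pi.smul_apply, smul_eq_mul]
  push_cast
  field_simp

theorem exists_eq_vecMul_of_dual {n q : ℕ} [NeZero q] {A : Matrix (Fin n) (Fin n) ℝ}
    (hA : IsUnit A.det) {N : Matrix (Fin n) (Fin n) ℤ} (hN : ∀ i j, A i j = (q : ℝ) * N i j)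
    {w : Fin n → ℤ}
    (hw : ∀ s : Fin n → ℤ, ∃ l : ℤ,
      (q : ℝ) * (((fun i => (s i : ℝ)) ᵥ* (Aᵀ)⁻¹) ⬝ᵥ fun i => (w i : ℝ)) = l) :
    ∃ k : Fin n → ℤ, w = k ᵥ* N := by
  have hq : (q : ℝ) ≠ 0 := NeZero.ne _
  choose k hk using fun j => hw (Pi.single j 1)
  refine ⟨k, ?_⟩
  have hk' : (q : ℝ) • ((Aᵀ)⁻¹ *ᵥ fun i => (w i : ℝ)) = fun j => (k j : ℝ) := by
    ext j
    rw [← hk j, ← Matrix.dotProduct_mulVec]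
    have : (fun i => ((Pi.single j 1 : Fin n → ℤ) i : ℝ)) = Pi.single j 1 := by
      ext i
      by_cases h : i = j
      · subst h; simp
      · simp [h]
    rw [this, single_one_dotProduct, Pi.smul_apply, smul_eq_mul]
  have h2 : (q : ℝ) • (fun i => (w i : ℝ)) = Aᵀ *ᵥ fun j => (k j : ℝ) := by
    rw [← hk', Matrix.mulVec_smul, Matrix.mulVec_mulVec,
      Matrix.mul_nonsing_inv _ (by rwa [Matrix.det_transpose]), Matrix.one_mulVec]
  ext i
  have h3 := congrFun h2 i
  simp only [Pi.smul_apply, smul_eq_mul, Matrix.mulVec, dotProduct, Matrix.transpose_apply, hN,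
    mul_assoc, ← Finset.mul_sum] at h3
  have h4 := mul_left_cancel₀ hq h3
  rw [Matrix.vecMul, dotProduct]
  have h5 : (w i : ℝ) = ((∑ j, k j * N j i : ℤ) : ℝ) := by
    rw [h4]
    push_cast
    exact Finset.sum_congr rfl fun j _ => mul_comm _ _
  exact_mod_cast h5

theorem intCast_smul_mulVec_apply_eq_zero {n q : ℕ} (N : Matrix (Fin n) (Fin n) ℤ) (a : Fin n → ℤ)
    (j : Fin n) : ((((q : ℤ) • N) *ᵥ a) j : ZMod q) = 0 := by
  rw [Matrix.smul_mulVec]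
  simp

theorem gaussSumChar_prod_mul_sum_quotient {n q : ℕ} [NeZero q]
    {χ : Fin n → DirichletCharacter ℂ q}
    (hχ : ∀ j, (χ j).IsPrimitive) {A : Matrix (Fin n) (Fin n) ℝ} (hA : IsUnit A.det)
    {N : Matrix (Fin n) (Fin n) ℤ} (hN : ∀ i j, A i j = (q : ℝ) * N i j)
    [Fintype ((Fin n → ℤ) ⧸ LinearMap.range ((q : ℤ) • N).mulVecLin)]
    (hcard : (Fintype.card ((Fin n → ℤ) ⧸ LinearMap.range ((q : ℤ) • N).mulVecLin) : ℝ) = |A.det|)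
    {F : (Fin n → ℤ) ⧸ LinearMap.range ((q : ℤ) • N).mulVecLin → ℂ} (k : Fin n → ℤ)
    (hF : ∀ m : Fin n → ℤ, F (Submodule.Quotient.mk m) =
      (∏ j, (starRingEnd ℂ) ((χ j) ((m j : ZMod q)))) *
        expTwoPiI (-(((fun i => (m i : ℝ)) ᵥ* (Aᵀ)⁻¹) ⬝ᵥ fun i => ((k ᵥ* N) i : ℝ)))) :
    (∏ j, gaussSumChar (χ j)) / ((|A.det| : ℝ) : ℂ) * ∑ c, F c = ∏ j, (χ j) (k j : ZMod q) := by
  let π₀ : (Fin n → ℤ) →+ (Fin n → ZMod q) := (Int.castAddHom (ZMod q)).compLeft (Fin n)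
  let f : (Fin n → ℤ) ⧸ LinearMap.range ((q : ℤ) • N).mulVecLin →+ (Fin n → ZMod q) :=
    (Submodule.liftQ _ π₀.toIntLinearMap (by
      rintro _ ⟨a, rfl⟩
      ext j
      exact intCast_smul_mulVec_apply_eq_zero N a j)).toAddMonoidHom
  have hf : ∀ m, f (Submodule.Quotient.mk m) = fun j => (m j : ZMod q) := fun m => rfl
  have hsurj : Function.Surjective f := fun v =>
    ⟨Submodule.Quotient.mk fun j => ((v j).val : ℤ), by ext j; simp [hf]⟩
  let u : (Fin n → ZMod q) → ℂ := fun v =>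
    ∏ j, ((χ j)⁻¹ (v j) * ZMod.stdAddChar (-(v j * (k j : ZMod q))))
  have hFu : ∀ c, F c = u (f c) := by
    intro c
    obtain ⟨m, rfl⟩ := Submodule.Quotient.mk_surjective _ c
    rw [hF, hf, dual_dotProduct_vecMul hA hN, ← Finset.sum_neg_distrib, expTwoPiI_sum,
      ← Finset.prod_mul_distrib]
    refine Finset.prod_congr rfl fun j _ => ?_
    have h1 := stdAddChar_intCast_eq_expTwoPiI (q := q) (-(m j * k j))
    push_cast at h1
    rw [← MulChar.star_apply', h1]
    push_cast
    rw [neg_div]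
    rfl
  have h1 := card_mul_sum_comp_of_surjective f hsurj u
  have h2 : ∑ v, u v = ∏ j, ∑ v : ZMod q, ((χ j)⁻¹ v * ZMod.stdAddChar (-(v * (k j : ZMod q)))) := by
    rw [Finset.prod_univ_sum, Fintype.piFinset_univ]
  have h3 : (∏ j, gaussSumChar (χ j)) * ∑ v, u v = (q : ℂ) ^ n * ∏ j, (χ j) (k j : ZMod q) := by
    rw [h2, ← Finset.prod_mul_distrib,
      Finset.prod_congr rfl fun j _ => gaussSumChar_mul_sum_inv_mul_stdAddChar (hχ j) _,
      Finset.prod_mul_distrib]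
    simp
  have hcard' : (Fintype.card ((Fin n → ℤ) ⧸ LinearMap.range ((q : ℤ) • N).mulVecLin) : ℂ) =
      ((|A.det| : ℝ) : ℂ) := by exact_mod_cast congrArg (fun r : ℝ => (r : ℂ)) hcard
  have hdet : ((|A.det| : ℝ) : ℂ) ≠ 0 := by
    exact_mod_cast abs_ne_zero.2 hA.ne_zero
  have hqn : (q : ℂ) ^ n ≠ 0 := pow_ne_zero _ (NeZero.ne _)
  have hQ : (Fintype.card (Fin n → ZMod q) : ℂ) = (q : ℂ) ^ n := by simp [ZMod.card]
  rw [hQ, hcard'] at h1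
  simp only [hFu]
  rw [div_mul_eq_mul_div, div_eq_iff hdet]
  refine mul_left_cancel₀ hqn ?_
  linear_combination (∏ j, gaussSumChar (χ j)) * h1 + ((|A.det| : ℝ) : ℂ) * h3

theorem sum_quotient_eq_zero {n q : ℕ} [NeZero q] {χ : Fin n → DirichletCharacter ℂ q}
    {A : Matrix (Fin n) (Fin n) ℝ} (hA : IsUnit A.det)
    {N : Matrix (Fin n) (Fin n) ℤ} (hN : ∀ i j, A i j = (q : ℝ) * N i j)
    [Fintype ((Fin n → ℤ) ⧸ LinearMap.range ((q : ℤ) • N).mulVecLin)]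
    {F : (Fin n → ℤ) ⧸ LinearMap.range ((q : ℤ) • N).mulVecLin → ℂ} {w : Fin n → ℤ}
    (hw : ¬ ∃ k : Fin n → ℤ, w = k ᵥ* N)
    (hF : ∀ m : Fin n → ℤ, F (Submodule.Quotient.mk m) =
      (∏ j, (starRingEnd ℂ) ((χ j) ((m j : ZMod q)))) *
        expTwoPiI (-(((fun i => (m i : ℝ)) ᵥ* (Aᵀ)⁻¹) ⬝ᵥ fun i => (w i : ℝ)))) :
    ∑ c, F c = 0 := by
  obtain ⟨s, hs⟩ : ∃ s : Fin n → ℤ, ¬ ∃ l : ℤ,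
      (q : ℝ) * (((fun i => (s i : ℝ)) ᵥ* (Aᵀ)⁻¹) ⬝ᵥ fun i => (w i : ℝ)) = l := by
    by_contra! h
    exact hw (exists_eq_vecMul_of_dual hA hN h)
  have hζ : expTwoPiI (-((q : ℝ) * (((fun i => (s i : ℝ)) ᵥ* (Aᵀ)⁻¹) ⬝ᵥ fun i => (w i : ℝ)))) ≠ 1 := by
    rw [Ne, expTwoPiI_eq_one_iff]
    rintro ⟨l, hl⟩
    exact hs ⟨-l, by push_cast; linarith⟩
  refine sum_eq_zero_of_add_right_eq_mul hζ (Submodule.Quotient.mk ((q : ℤ) • s)) fun c => ?_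
  obtain ⟨m, rfl⟩ := Submodule.Quotient.mk_surjective _ c
  have hqs : (fun i => ((((q : ℤ) • s) i : ℤ) : ℝ)) = (q : ℝ) • fun i => (s i : ℝ) := by
    ext i
    simp
  rw [← Submodule.Quotient.mk_add, hF, hF, dual_add, add_dotProduct, neg_add, expTwoPiI_add, hqs,
    Matrix.smul_vecMul, smul_dotProduct, smul_eq_mul]
  have : ∀ j, (((m + (q : ℤ) • s) j : ℤ) : ZMod q) = m j := fun j => by simp
  simp only [this]
  ring

theorem hasSum_prod_besselI {n : ℕ} (t : Fin n → ℂ) (u : Fin n → ℝ) :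
    HasSum (fun z : Fin n → ℤ => (∏ j, besselI (z j) (t j)) * expTwoPiI (u ⬝ᵥ fun j => (z j : ℝ)))
      (∏ j, Complex.exp (t j * Real.cos (2 * π * u j))) := by
  refine (hasSum_prod_pi_int fun j => hasSum_besselI_mul_exp (t j) (u j)).congr_fun fun z => ?_
  rw [Finset.prod_mul_distrib, dotProduct, expTwoPiI_sum]
  simp [expTwoPiI]

/-- Theorem 1.1 of the paper. For primitive Dirichlet characters
`χ_1,…,χ_n` mod `q` and a sublattice `Γ = ℤ^n A ⊆ ℤ^n` all entries of whose matrix `A`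
are integers divisible by `q`, for any `t ∈ ℂ^n`, `x ∈ ℤ^n`, `y ∈ ℝ^n`:
`Σ_{γ∈Γ} χ(γA⁻¹) (∏_j I_{x_j+γ_j/q}(t_j)) e^{2πi⟨y,x+γ/q⟩}
  = (∏_j G(χ_j)/vol(ℝ^n/Γ)) Σ_{γ*∈Γ*} χ̄(γ* ᵗA)
      (∏_j 1_{[-1/2,1/2]}(y_j−γ*_j) e^{t_j cos 2π(y_j−γ*_j)}) e^{2πi⟨x,γ*⟩}`,
with `γ = k ᵥ* A`, `γA⁻¹ = k` and `γ* = m ᵥ* (Aᵀ)⁻¹`, `γ* ᵗA = m` for `k, m ∈ ℤ^n`. -/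
theorem besselI_lattice_sum_with_characters (n q : ℕ) (hq : 1 ≤ q)
    (χ : Fin n → DirichletCharacter ℂ q) (hχ : ∀ j, (χ j).IsPrimitive)
    (A : Matrix (Fin n) (Fin n) ℝ) (hA : IsUnit A.det)
    (hAq : ∀ i j, ∃ z : ℤ, A i j = (q : ℝ) * (z : ℝ))
    (t : Fin n → ℂ) (x : Fin n → ℤ) (y : Fin n → ℝ) :
    ∑' k : Fin n → ℤ,
      (∏ j, (χ j) ((k j : ZMod q))) *
        (∏ j, besselI ((x j : ℝ) + ((fun i => (k i : ℝ)) ᵥ* A) j / (q : ℝ)) (t j)) *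
        Complex.exp (2 * Real.pi * I *
          ∑ j, (y j : ℂ) * (((x j : ℝ) + ((fun i => (k i : ℝ)) ᵥ* A) j / (q : ℝ) : ℝ) : ℂ)) =
    ((∏ j, gaussSumChar (χ j)) / ((|A.det| : ℝ) : ℂ)) *
      ∑' m : Fin n → ℤ,
        (∏ j, (starRingEnd ℂ) ((χ j) ((m j : ZMod q)))) *
          (∏ j, (rect (y j - ((fun i => (m i : ℝ)) ᵥ* (Aᵀ)⁻¹) j) : ℂ) *
            Complex.exp (t j *
              Real.cos (2 * Real.pi * (y j - ((fun i => (m i : ℝ)) ᵥ* (Aᵀ)⁻¹) j)))) *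
          Complex.exp (2 * Real.pi * I *
            ∑ j, (x j : ℂ) * (((fun i => (m i : ℝ)) ᵥ* (Aᵀ)⁻¹) j : ℂ)) := by
  have : NeZero q := ⟨by omega⟩
  have hq0 : (q : ℝ) ≠ 0 := NeZero.ne _
  obtain ⟨N, hN⟩ : ∃ N : Matrix (Fin n) (Fin n) ℤ, ∀ i j, A i j = (q : ℝ) * N i j := by
    choose N hN using hAq
    exact ⟨N, hN⟩
  have hM : ∀ i j, A i j = (((q : ℤ) • N) i j : ℝ) := fun i j => by simp [hN]
  have hAM : A = (((q : ℤ) • N).map (Int.castRingHom ℝ)) := by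
    ext i j
    rw [hM]
    rfl
  have hAdet : A.det = ((((q : ℤ) • N).det : ℤ) : ℝ) := by
    rw [hAM, ← RingHom.mapMatrix_apply, ← RingHom.map_det]
    rfl
  have hMdet : ((q : ℤ) • N).det ≠ 0 := fun h => hA.ne_zero (by rw [hAdet, h, Int.cast_zero])
  have hnat := natCard_quotient_range_mulVecLin hMdet
  have : Finite ((Fin n → ℤ) ⧸ LinearMap.range ((q : ℤ) • N).mulVecLin) :=
    Nat.finite_of_card_ne_zero (by rw [hnat]; exact Int.natAbs_ne_zero.2 hMdet)
  have := Fintype.ofFinite ((Fin n → ℤ) ⧸ LinearMap.range ((q : ℤ) • N).mulVecLin)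
  have hcard : (Fintype.card ((Fin n → ℤ) ⧸ LinearMap.range ((q : ℤ) • N).mulVecLin) : ℝ) =
      |A.det| := by
    rw [← Nat.card_eq_fintype_card, hnat, hAdet, Nat.cast_natAbs, Int.cast_abs]
  obtain ⟨γ, hγ⟩ : ∃ γ : (Fin n → ℤ) → Fin n → ℝ,
      ∀ m, γ m = (fun i => (m i : ℝ)) ᵥ* (Aᵀ)⁻¹ := ⟨_, fun _ => rfl⟩
  have hγadd : ∀ m a, γ (m + ((q : ℤ) • N) *ᵥ a) = γ m + fun i => (a i : ℝ) := fun m a => by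
    rw [hγ, dual_add, dual_mulVec hA hM, hγ]
  obtain ⟨ψ, hψ⟩ : ∃ ψ : (Fin n → ℤ) → ℂ,
      ∀ m, ψ m = ∏ j, (starRingEnd ℂ) ((χ j) ((m j : ZMod q))) := ⟨_, fun _ => rfl⟩
  have hψadd : ∀ m a, ψ (m + ((q : ℤ) • N) *ᵥ a) = ψ m := fun m a => by
    simp only [hψ, Pi.add_apply, Int.cast_add, intCast_smul_mulVec_apply_eq_zero, add_zero]
  have hlift : ∀ g : (Fin n → ℤ) → ℂ, (∀ m a, g (m + ((q : ℤ) • N) *ᵥ a) = g m) →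
      ∃ G : (Fin n → ℤ) ⧸ LinearMap.range ((q : ℤ) • N).mulVecLin → ℂ,
        ∀ m, G (Submodule.Quotient.mk m) = g m := by
    intro g hg
    refine ⟨fun c => Quotient.liftOn' c g fun m m' h => ?_, fun m => rfl⟩
    obtain ⟨a, ha⟩ := (Submodule.quotientRel_def _).1 h
    rw [Matrix.mulVecLin_apply] at ha
    rw [← hg m' a, ha, add_sub_cancel]
  have hexp : ∀ a z : Fin n → ℤ,
      expTwoPiI ((fun i => (a i : ℝ)) ⬝ᵥ fun i => (z i : ℝ)) = 1 := fun a z =>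
    (expTwoPiI_eq_one_iff _).2 ⟨a ⬝ᵥ z, by simp [dotProduct]⟩
  have hexp_neg : ∀ a z : Fin n → ℤ,
      expTwoPiI (-((fun i => (a i : ℝ)) ⬝ᵥ fun i => (z i : ℝ))) = 1 := fun a z =>
    (expTwoPiI_eq_one_iff _).2 ⟨-(a ⬝ᵥ z), by simp [dotProduct]⟩
  choose F hF using fun w : Fin n → ℤ =>
    hlift (fun m => ψ m * expTwoPiI (-(γ m ⬝ᵥ fun i => (w i : ℝ)))) fun m a => by
      simp only [hψadd, hγadd, add_dotProduct, neg_add, expTwoPiI_add, hexp_neg, mul_one]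
  obtain ⟨h, hh⟩ := hlift (fun m => ψ m * expTwoPiI (γ m ⬝ᵥ fun i => (x i : ℝ)) *
      ∏ j, Complex.exp (t j * Real.cos (2 * π * (y j - γ m j)))) fun m a => by
    have hcos : ∀ j, Real.cos (2 * π * (y j - (γ m j + a j))) =
        Real.cos (2 * π * (y j - γ m j)) := fun j => by
      rw [← Real.cos_sub_int_mul_two_pi (2 * π * (y j - γ m j)) (a j)]
      congr 1
      ring
    simp only [hψadd, hγadd, add_dotProduct, expTwoPiI_add, hexp, mul_one, Pi.add_apply, hcos]
  set C : ℂ := (∏ j, gaussSumChar (χ j)) / ((|A.det| : ℝ) : ℂ) with hC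
  set P : (Fin n → ℤ) → ℂ := fun z =>
    (∏ j, besselI (z j) (t j)) * expTwoPiI (y ⬝ᵥ fun j => (z j : ℝ)) with hP
  have hsum : ∀ c, HasSum (fun z : Fin n → ℤ => F (z - x) c * P z) (h c) := by
    intro c
    obtain ⟨m, rfl⟩ := Submodule.Quotient.mk_surjective _ c
    have := (hasSum_prod_besselI t (y - γ m)).mul_left
      (ψ m * expTwoPiI (γ m ⬝ᵥ fun i => (x i : ℝ)))
    rw [hh]
    refine this.congr_fun fun z => ?_
    have hz : -(γ m ⬝ᵥ fun i => (((z - x) i : ℤ) : ℝ)) + y ⬝ᵥ (fun j => (z j : ℝ)) =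
        γ m ⬝ᵥ (fun i => (x i : ℝ)) + (y - γ m) ⬝ᵥ fun j => (z j : ℝ) := by
      have : (fun i => (((z - x) i : ℤ) : ℝ)) = (fun i => (z i : ℝ)) - fun i => (x i : ℝ) := by
        ext i
        simp
      rw [this, dotProduct_sub, sub_dotProduct]
      ring
    have hz' := congrArg expTwoPiI hz
    rw [expTwoPiI_add, expTwoPiI_add] at hz'
    rw [hF, hP]
    linear_combination (ψ m * ∏ j, besselI (z j) (t j)) * hz'
  have htotal : HasSum (fun z : Fin n → ℤ => C * (∑ c, F (z - x) c) * P z) (C * ∑ c, h c) := by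
    refine ((hasSum_sum fun c (_ : c ∈ Finset.univ) => hsum c).mul_left C).congr_fun fun z => ?_
    rw [← Finset.sum_mul, mul_assoc]
  have hinj : Function.Injective fun k : Fin n → ℤ => x + k ᵥ* N := by
    have hNdet : N.det ≠ 0 := fun h0 => hMdet (by rw [Matrix.det_smul, h0, mul_zero])
    simp only [← Matrix.mulVec_transpose]
    exact (add_right_injective x).comp
      (Matrix.mulVec_injective_of_det_ne_zero (by rwa [Matrix.det_transpose]))
  have hleft : HasSum (fun k : Fin n → ℤ => (∏ j, (χ j) (k j : ZMod q)) * P (x + k ᵥ* N))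
      (C * ∑ c, h c) := by
    rw [← hinj.hasSum_iff] at htotal
    · refine htotal.congr_fun fun k => ?_
      simp only [Function.comp_apply]
      rw [← gaussSumChar_prod_mul_sum_quotient hχ hA hN hcard (F := F (x + k ᵥ* N - x)) k
        fun m => by rw [hF, hψ, hγ, add_sub_cancel_left]]
    · intro z hz
      rw [sum_quotient_eq_zero (χ := χ) hA hN (w := z - x) _ fun m => by rw [hF, hψ, hγ],
        mul_zero, zero_mul]
      rintro ⟨k, hk⟩
      exact hz ⟨k, by simp [← hk]⟩
  have hright := hasSum_mul_of_periodic (φ := ((q : ℤ) • N).mulVecLin)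
    (Matrix.mulVec_injective_of_det_ne_zero hMdet) h
    (w := fun m => ∏ j, (rect (y j - γ m j) : ℂ)) fun m => by
      have := hasSum_prod_pi_int fun j => hasSum_rect_sub_int (y j - γ m j)
      rw [Finset.prod_const_one] at this
      refine this.congr_fun fun a => ?_
      simp only [Matrix.mulVecLin_apply, hγadd, Pi.add_apply, sub_sub]
  have hleft' := hleft.tsum_eq
  rw [← hright.tsum_eq] at hleft'
  simp only [← hγ, ← hψ]
  refine Eq.trans (tsum_congr fun k => ?_) (hleft'.trans ?_)
  · have hk : ∀ j, (x j : ℝ) + ((fun i => (k i : ℝ)) ᵥ* A) j / (q : ℝ) = ((x + k ᵥ* N) j : ℤ) := by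
      intro j
      simp only [Matrix.vecMul, dotProduct, hN, Pi.add_apply, Int.cast_add, Int.cast_sum,
        Int.cast_mul, Finset.sum_div]
      congr 1
      refine Finset.sum_congr rfl fun i _ => ?_
      field_simp
    simp only [hk, hP, mul_assoc, expTwoPiI, dotProduct, Complex.ofReal_sum, Complex.ofReal_mul]
  · congr 1
    refine tsum_congr fun m => ?_
    rw [hh, Finset.prod_mul_distrib, expTwoPiI, dotProduct]
    have : (((∑ i, γ m i * (x i : ℝ)) : ℝ) : ℂ) = ∑ j, (x j : ℂ) * (γ m j : ℂ) := by
      push_cast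
      exact Finset.sum_congr rfl fun j _ => mul_comm _ _
    rw [this]
    ring
end

section
/- Let q ≥ 1 and for j = 1,…,n let χ_j be a primitive Dirichlet character modulo q; set χ((a_1,…,a_n)) = ∏_{j=1}^n χ_j(a_j). Let Γ = ℤ^n A with A ∈ GL_n(ℝ) be a sublattice of ℤ^n such that every entry of A is divisible by q. Then for all (t_1,…,t_n) ∈ ℝ_{>0}^n, x ∈ ℤ^n and y ∈ ℝ^n: (1/(2π)^{n/2}) Σ_{γ=(γ_j)∈Γ} χ(γA^{-1}) exp(−(1/2) Σ_{j=1}^n (x_j+γ_j/q)²/t_j + 2πi⟨y, x+γ/q⟩) = (∏_{j=1}^n G(χ_j) / vol(ℝ^n/Γ)) · Σ_{γ*=(γ*_j)∈Γ*} \bar{χ}(γ* ᵗA) (∏_{j=1}^n √t_j) exp(−2π² Σ_{j=1}^n (y_j−γ*_j)² t_j + 2πi⟨x, γ*⟩). -/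
open scoped Real
open Complex Matrix

/-- A countable product of summable nonnegative functions of one variable is summable. -/
theorem summable_fin_prod_of_nonneg {β : Type*} {f : β → ℝ} (hf : Summable f) (h0 : ∀ b, 0 ≤ f b) :
    ∀ n : ℕ, Summable fun m : Fin n → β => ∏ i, f (m i)
  | 0 => Summable.of_finite
  | n + 1 => by
    rw [← (Fin.consEquiv fun _ : Fin (n + 1) => β).summable_iff]
    have := hf.mul_of_nonneg (summable_fin_prod_of_nonneg hf h0 n) h0
      (fun m => Finset.prod_nonneg fun i _ => h0 _)
    refine this.congr fun p => ?_
    simp [Fin.prod_univ_succ, Fin.consEquiv]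

/-- The half-open unit cube in `ℝⁿ` with lower corner `a`. -/
def unitCube {n : ℕ} (a : Fin n → ℝ) : Set (Fin n → ℝ) :=
  {x | ∀ i, x i ∈ Set.Ioc (a i) (a i + 1)}

theorem measurableSet_unitCube {n : ℕ} (a : Fin n → ℝ) : MeasurableSet (unitCube a) :=
  MeasurableSet.univ_pi' fun _ => measurableSet_Ioc

theorem volume_unitCube {n : ℕ} (a : Fin n → ℝ) : MeasureTheory.volume (unitCube a) = 1 := by
  have : unitCube a = Set.pi Set.univ fun i => Set.Ioc (a i) (a i + 1) := by
    ext x; simp [unitCube, Set.mem_pi]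
  rw [this, MeasureTheory.volume_pi_pi]
  simp

theorem iUnion_unitCube (n : ℕ) : ⋃ m : Fin n → ℤ, unitCube (fun i => (m i : ℝ)) = Set.univ := by
  refine Set.eq_univ_of_forall fun x => Set.mem_iUnion.2 ⟨fun i => ⌈x i⌉ - 1, fun i => ?_⟩
  constructor
  · push_cast; linarith [Int.ceil_lt_add_one (x i)]
  · push_cast; linarith [Int.le_ceil (x i)]

theorem pairwise_disjoint_unitCube (n : ℕ) :
    Pairwise (Function.onFun Disjoint fun m : Fin n → ℤ => unitCube fun i => (m i : ℝ)) := by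
  intro m m' hne
  refine Set.disjoint_left.2 fun x hx hx' => hne (funext fun i => ?_)
  have h1 := hx i
  have h2 := hx' i
  have h3 : (m i : ℝ) < m' i + 1 := h1.1.trans_le h2.2
  have h4 : (m' i : ℝ) < m i + 1 := h2.1.trans_le h1.2
  norm_cast at h3 h4
  omega

/-- The integral over `ℝⁿ` is the sum of the integrals of the integer translates over the unit
cube. -/
theorem integral_eq_tsum_unitCube {n : ℕ} {f : (Fin n → ℝ) → ℂ} (hf : MeasureTheory.Integrable f) :
    ∫ x, f x = ∑' m : Fin n → ℤ, ∫ x in unitCube 0, f (x + fun i => (m i : ℝ)) := by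
  rw [← MeasureTheory.setIntegral_univ, ← iUnion_unitCube,
    MeasureTheory.integral_iUnion (fun _ => measurableSet_unitCube _) (pairwise_disjoint_unitCube n)
      hf.integrableOn]
  refine tsum_congr fun m => ?_
  rw [← (MeasureTheory.measurePreserving_add_right MeasureTheory.volume
    (fun i => (m i : ℝ))).setIntegral_preimage_emb (measurableEmbedding_addRight _)]
  congr 2
  ext x
  refine forall_congr' fun i => ?_
  simp only [Pi.add_apply, Pi.zero_apply, Set.mem_Ioc]
  constructor <;> rintro ⟨h1, h2⟩ <;> constructor <;> linarith

/-- The integral over `ℝⁿ` is the integral over the unit cube of the periodization. -/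
theorem integral_eq_integral_unitCube_tsum {n : ℕ} {f : (Fin n → ℝ) → ℂ}
    (hf : MeasureTheory.Integrable f) {u : (Fin n → ℤ) → ℝ} (hu : Summable u)
    (hub : ∀ m : Fin n → ℤ, ∀ v ∈ unitCube (0 : Fin n → ℝ), ‖f (v + fun i => (m i : ℝ))‖ ≤ u m) :
    ∫ v, f v = ∫ v in unitCube 0, ∑' m : Fin n → ℤ, f (v + fun i => (m i : ℝ)) := by
  rw [integral_eq_tsum_unitCube hf]
  refine MeasureTheory.integral_tsum_of_summable_integral_norm
    (fun m => (hf.comp_add_right _).integrableOn)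
    (Summable.of_nonneg_of_le (fun m => MeasureTheory.integral_nonneg fun _ => norm_nonneg _)
      (fun m => ?_) hu)
  have := MeasureTheory.norm_setIntegral_le_of_norm_le_const (μ := MeasureTheory.volume)
    (s := unitCube (0 : Fin n → ℝ)) (C := u m) (f := fun v => ‖f (v + fun i => (m i : ℝ))‖)
    (by simp [volume_unitCube]) (fun v hv => (norm_norm _).le.trans (hub m v hv))
  rw [MeasureTheory.measureReal_def, volume_unitCube] at this
  exact (le_abs_self _).trans (this.trans (by simp))

/-- The Fourier transform of a function on `ℝⁿ` at an integer point. -/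
noncomputable def intFourier {n : ℕ} (f : (Fin n → ℝ) → ℂ) (p : Fin n → ℤ) : ℂ :=
  ∫ v, cexp (-(2 * π * I * ∑ i, (p i : ℂ) * v i)) * f v

theorem mFourier_coe {n : ℕ} (p : Fin n → ℤ) (x : Fin n → ℝ) :
    UnitAddTorus.mFourier p (fun i => (x i : UnitAddCircle)) =
      cexp (2 * π * I * ∑ i, (p i : ℂ) * x i) := by
  simp only [UnitAddTorus.mFourier, ContinuousMap.coe_mk, fourier_coe_apply, Finset.mul_sum,
    Complex.exp_sum]
  refine Finset.prod_congr rfl fun i _ => ?_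
  congr 1
  push_cast
  ring

theorem cexp_add_int {n : ℕ} (p m : Fin n → ℤ) (v : Fin n → ℝ) :
    cexp (-(2 * π * I * ∑ i, (p i : ℂ) * ((v i + m i : ℝ) : ℂ))) =
      cexp (-(2 * π * I * ∑ i, (p i : ℂ) * v i)) := by
  refine Complex.exp_eq_exp_iff_exists_int.2 ⟨-∑ i, p i * m i, ?_⟩
  push_cast
  simp only [mul_add, Finset.sum_add_distrib]
  ring

theorem norm_cexp_neg_two_pi_I_sum {n : ℕ} (p : Fin n → ℤ) (v : Fin n → ℝ) :
    ‖cexp (-(2 * π * I * ∑ i, (p i : ℂ) * v i))‖ = 1 := by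
  rw [show -(2 * π * I * ∑ i, (p i : ℂ) * v i) = ((-(2 * π * ∑ i, (p i : ℝ) * v i) : ℝ) : ℂ) * I by
    push_cast; ring]
  exact Complex.norm_exp_ofReal_mul_I _

/-- Poisson summation on `ℝⁿ` for a continuous integrable function whose sums over integer
translates are locally normally convergent and whose Fourier transform is summable on `ℤⁿ`. -/
theorem tsum_int_translates_eq_tsum_intFourier {n : ℕ} {f : (Fin n → ℝ) → ℂ} (hc : Continuous f)
    (hf : MeasureTheory.Integrable f)
    (hb : ∀ R : ℝ, ∃ u : (Fin n → ℤ) → ℝ, Summable u ∧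
      ∀ v : Fin n → ℝ, ‖v‖ ≤ R → ∀ m : Fin n → ℤ, ‖f (v + fun i => (m i : ℝ))‖ ≤ u m)
    (hs : Summable (intFourier f)) (x : Fin n → ℝ) :
    ∑' m : Fin n → ℤ, f (x + fun i => (m i : ℝ)) =
      ∑' p : Fin n → ℤ, intFourier f p * cexp (2 * π * I * ∑ i, (p i : ℂ) * x i) := by
  set H : (Fin n → ℝ) → ℂ := fun v => ∑' m : Fin n → ℤ, f (v + fun i => (m i : ℝ)) with hH
  have hHc : Continuous H := by
    refine continuous_iff_continuousAt.2 fun v => ?_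
    obtain ⟨u, hu, hub⟩ := hb (‖v‖ + 1)
    have : ContinuousOn H (Metric.closedBall 0 (‖v‖ + 1)) :=
      continuousOn_tsum (fun m => (hc.comp (continuous_add_const _)).continuousOn) hu
        fun m w hw => hub w (by simpa using hw) m
    exact this.continuousAt (Metric.closedBall_mem_nhds_of_mem (by simp))
  have hHper (v : Fin n → ℝ) (k : Fin n → ℤ) : H (v + fun i => (k i : ℝ)) = H v := by
    simp only [hH]
    rw [← (Equiv.addLeft k).tsum_eq fun m : Fin n → ℤ => f (v + fun i => (m i : ℝ))]
    refine tsum_congr fun m => congrArg f ?_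
    ext i
    simp [add_assoc]
  have hq : IsOpenQuotientMap (Pi.map fun (_ : Fin n) (a : ℝ) => (a : UnitAddCircle)) :=
    IsOpenQuotientMap.piMap fun _ => QuotientAddGroup.isOpenQuotientMap_mk
  have hfac :
      Function.FactorsThrough H (Pi.map fun (_ : Fin n) (a : ℝ) => (a : UnitAddCircle)) := by
    intro a b hab
    have h1 (i : Fin n) : ∃ k : ℤ, b i - a i = k := by
      have := congrFun hab i
      simp only [Pi.map_apply] at this
      obtain ⟨k, hk⟩ := AddSubgroup.mem_zmultiples_iff.1 (QuotientAddGroup.eq.1 this)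
      exact ⟨k, by simp at hk; linarith⟩
    choose k hk using h1
    have : b = a + fun i => (k i : ℝ) := by
      ext i; simp [← hk]
    rw [this, hHper]
  let F : C(UnitAddTorus (Fin n), ℂ) :=
    Topology.IsQuotientMap.lift (f := ⟨_, hq.continuous⟩) hq.isQuotientMap ⟨H, hHc⟩ hfac
  have hF (v : Fin n → ℝ) : F (fun i => (v i : UnitAddCircle)) = H v :=
    DFunLike.congr_fun (Topology.IsQuotientMap.lift_comp (f := ⟨_, hq.continuous⟩) hq.isQuotientMap
      ⟨H, hHc⟩ hfac) v
  have hcoeff : UnitAddTorus.mFourierCoeff F = intFourier f := by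
    ext p
    have hi : MeasureTheory.Integrable
        fun v : Fin n → ℝ => cexp (-(2 * π * I * ∑ i, (p i : ℂ) * v i)) * f v := by
      refine hf.bdd_mul (c := 1) (Continuous.aestronglyMeasurable (by fun_prop)) ?_
      exact Filter.Eventually.of_forall fun v => (norm_cexp_neg_two_pi_I_sum p v).le
    obtain ⟨u, hu, hub⟩ := hb 1
    rw [intFourier, integral_eq_integral_unitCube_tsum hi hu,
      UnitAddTorus.mFourierCoeff_eq_integral _ p 0]
    · refine MeasureTheory.setIntegral_congr_fun (measurableSet_unitCube 0) fun v _ => ?_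
      simp only [mFourier_coe, hF, hH, smul_eq_mul, Pi.add_apply, cexp_add_int]
      rw [tsum_mul_left]
      simp
    · intro m v hv
      rw [norm_mul, norm_cexp_neg_two_pi_I_sum, one_mul]
      refine hub v ((pi_norm_le_iff_of_nonneg zero_le_one).2 fun i => ?_) m
      have := hv i
      simp only [Pi.zero_apply, zero_add, Set.mem_Ioc] at this
      rw [Real.norm_eq_abs, abs_le]
      constructor <;> linarith [this.1, this.2]
  have := UnitAddTorus.hasSum_mFourier_series_apply_of_summable (f := F) (by rwa [hcoeff])
    (fun i => (x i : UnitAddCircle))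
  rw [hF, hcoeff] at this
  simp only [mFourier_coe, smul_eq_mul] at this
  exact this.tsum_eq.symm

theorem sum_fin_eq_sum_zmod {q : ℕ} [NeZero q] (f : ZMod q → ℂ) :
    ∑ a : Fin q, f ((a : ℕ) : ZMod q) = ∑ a, f a := by
  obtain ⟨k, rfl⟩ := Nat.exists_eq_succ_of_ne_zero (NeZero.ne q)
  exact Finset.sum_congr rfl fun a _ => congrArg f (ZMod.natCast_zmod_val (n := k + 1) a)

/-- The finite Fourier transform of a primitive Dirichlet character. -/
theorem sum_char_mul_exp {q : ℕ} [NeZero q] {χ : DirichletCharacter ℂ q} (hχ : χ.IsPrimitive)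
    (p : ℤ) :
    ∑ a : Fin q, χ ((a : ℕ) : ZMod q) * cexp (2 * π * I * (p * (((a : ℕ) : ℝ) / (q : ℝ) : ℝ))) =
      (starRingEnd ℂ) (χ (p : ZMod q)) * gaussSumChar χ := by
  have h := gaussSum_mulShift_of_isPrimitive (ZMod.stdAddChar (N := q)) hχ (p : ZMod q)
  rw [gaussSumChar_eq_gaussSum, starRingEnd_apply, MulChar.star_apply', ← h, gaussSum,
    ← sum_fin_eq_sum_zmod]
  refine Finset.sum_congr rfl fun a _ => ?_
  have := ZMod.stdAddChar_coe (N := q) (p * ((a : ℕ) : ℤ))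
  rw [AddChar.mulShift_apply]
  push_cast at this ⊢
  rw [this]
  congr 2
  ring

theorem summable_exp_neg_mul_sq {c : ℝ} (hc : 0 < c) :
    Summable fun k : ℤ => rexp (-c * (k : ℝ) ^ 2) := by
  refine (summable_pow_mul_jacobiTheta₂_term_bound 0 (div_pos hc Real.pi_pos) 0).congr fun k => ?_
  rw [pow_zero, one_mul]
  congr 1
  field_simp
  ring

/-- Sums over `ℤⁿ` of a shifted nondegenerate Gaussian converge locally normally in the shift. -/
theorem exists_summable_gaussian_bound {n : ℕ} {B : Matrix (Fin n) (Fin n) ℝ} (hB : IsUnit B.det)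
    {s : Fin n → ℝ} (hs : ∀ j, 0 < s j) (R : ℝ) :
    ∃ u : (Fin n → ℤ) → ℝ, Summable u ∧ ∀ w : Fin n → ℝ, ‖w‖ ≤ R → ∀ m : Fin n → ℤ,
      rexp (-∑ j, s j * (w j + ((fun i => (m i : ℝ)) ᵥ* B) j) ^ 2) ≤ u m := by
  obtain ⟨σ, hσ, hσs⟩ : ∃ σ : ℝ, 0 < σ ∧ ∀ j, σ ≤ s j := by
    have hp : 0 < 1 + ∑ j, (s j)⁻¹ := by
      have := Finset.sum_nonneg fun j (_ : j ∈ Finset.univ) => (inv_pos.2 (hs j)).le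
      linarith
    refine ⟨(1 + ∑ j, (s j)⁻¹)⁻¹, inv_pos.2 hp, fun j => inv_le_of_inv_le₀ (hs j) ?_⟩
    have := Finset.single_le_sum (fun j _ => (inv_pos.2 (hs j)).le) (Finset.mem_univ j)
    linarith
  obtain ⟨K, hK, hKB⟩ : ∃ K : ℝ, 0 < K ∧ ∀ v : Fin n → ℝ, ‖v‖ ≤ K * ‖v ᵥ* B‖ := by
    let L := LinearMap.toContinuousLinearMap (Matrix.vecMulLinear B⁻¹)
    refine ⟨‖L‖ + 1, by positivity, fun v => ?_⟩
    have h1 : L (v ᵥ* B) = v := by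
      simp [L, Matrix.vecMul_vecMul, Matrix.mul_nonsing_inv B hB]
    calc ‖v‖ = ‖L (v ᵥ* B)‖ := by rw [h1]
      _ ≤ ‖L‖ * ‖v ᵥ* B‖ := L.le_opNorm _
      _ ≤ _ := by gcongr; linarith
  have hsq (v : Fin n → ℝ) : σ * ‖v‖ ^ 2 ≤ ∑ j, s j * v j ^ 2 := by
    have h0 : ∀ j, 0 ≤ s j * v j ^ 2 := fun j => mul_nonneg (hs j).le (sq_nonneg _)
    have h1 : ‖v‖ ≤ √((∑ j, s j * v j ^ 2) / σ) := by
      refine (pi_norm_le_iff_of_nonneg (Real.sqrt_nonneg _)).2 fun j => Real.le_sqrt_of_sq_le ?_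
      rw [Real.norm_eq_abs, sq_abs, le_div_iff₀ hσ]
      calc v j ^ 2 * σ ≤ s j * v j ^ 2 := by nlinarith [hσs j, sq_nonneg (v j)]
        _ ≤ _ := Finset.single_le_sum (fun j _ => h0 j) (Finset.mem_univ j)
    have h2 := pow_le_pow_left₀ (norm_nonneg v) h1 2
    rw [Real.sq_sqrt (div_nonneg (Finset.sum_nonneg fun j _ => h0 j) hσ.le), le_div_iff₀ hσ] at h2
    linarith
  set c : ℝ := σ / (2 * K ^ 2) / (n + 1) with hc
  have hc0 : 0 < c := by positivity
  refine ⟨fun m => rexp (σ * R ^ 2) * ∏ i, rexp (-c * (m i : ℝ) ^ 2),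
    (summable_fin_prod_of_nonneg (summable_exp_neg_mul_sq hc0)
      (fun _ => (Real.exp_pos _).le) n).mul_left _, fun w hw m => ?_⟩
  beta_reduce
  rw [← Real.exp_sum, ← Real.exp_add, Real.exp_le_exp]
  set mr : Fin n → ℝ := fun i => (m i : ℝ)
  have h1 := hsq (w + mr ᵥ* B)
  have h2 : ∑ i, (m i : ℝ) ^ 2 ≤ (n + 1) * ‖mr‖ ^ 2 := by
    calc ∑ i, (m i : ℝ) ^ 2 ≤ ∑ i : Fin n, ‖mr‖ ^ 2 := by
          refine Finset.sum_le_sum fun i _ => ?_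
          rw [← sq_abs]
          exact pow_le_pow_left₀ (abs_nonneg _) (norm_le_pi_norm mr i) 2
      _ = n * ‖mr‖ ^ 2 := by simp
      _ ≤ _ := by nlinarith [sq_nonneg ‖mr‖]
  have h3 : ‖mr ᵥ* B‖ ≤ ‖w + mr ᵥ* B‖ + ‖w‖ := by
    simpa using norm_sub_le (w + mr ᵥ* B) w
  have h4 : ‖mr‖ ^ 2 ≤ K ^ 2 * (2 * ‖w + mr ᵥ* B‖ ^ 2 + 2 * R ^ 2) := by
    calc ‖mr‖ ^ 2 ≤ (K * ‖mr ᵥ* B‖) ^ 2 := pow_le_pow_left₀ (norm_nonneg _) (hKB mr) 2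
      _ = K ^ 2 * ‖mr ᵥ* B‖ ^ 2 := by ring
      _ ≤ _ := by
        gcongr
        have h5 : ‖mr ᵥ* B‖ ≤ ‖w + mr ᵥ* B‖ + R := by linarith
        have := pow_le_pow_left₀ (norm_nonneg _) h5 2
        nlinarith [sq_nonneg (‖w + mr ᵥ* B‖ - R)]
  have h6 : c * ∑ i, (m i : ℝ) ^ 2 ≤ σ * ‖w + mr ᵥ* B‖ ^ 2 + σ * R ^ 2 := by
    calc c * ∑ i, (m i : ℝ) ^ 2
        ≤ c * ((n + 1) * (K ^ 2 * (2 * ‖w + mr ᵥ* B‖ ^ 2 + 2 * R ^ 2))) := by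
          gcongr
          exact h2.trans (by gcongr)
      _ = _ := by
        rw [hc]
        field_simp
  rw [← Finset.mul_sum]
  simp only [Pi.add_apply] at h1
  linarith

theorem measurableEmbedding_toLin'_transpose {n : ℕ} {A : Matrix (Fin n) (Fin n) ℝ}
    (hA : IsUnit A.det) : MeasurableEmbedding (toLin' Aᵀ) :=
  (LinearEquiv.ofIsUnitDet (f := toLin' Aᵀ) (v := Pi.basisFun ℝ (Fin n))
    (v' := Pi.basisFun ℝ (Fin n))
    (by simpa using hA)).toContinuousLinearEquiv.toHomeomorph.measurableEmbedding

/-- Linear change of variables `v ↦ v ᵥ* A` in an integral over `ℝⁿ`. -/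
theorem integral_comp_vecMul {n : ℕ} {A : Matrix (Fin n) (Fin n) ℝ} (hA : IsUnit A.det)
    (g : (Fin n → ℝ) → ℂ) :
    ∫ v, g (v ᵥ* A) = ((|A.det| : ℝ) : ℂ)⁻¹ * ∫ v, g v := by
  have hdet : Aᵀ.det ≠ 0 := by rw [det_transpose]; exact hA.ne_zero
  have h := Real.map_matrix_volume_pi_eq_smul_volume_pi hdet
  have h2 := (measurableEmbedding_toLin'_transpose hA).integral_map (μ := MeasureTheory.volume) g
  rw [h, MeasureTheory.integral_smul_measure] at h2
  simp only [toLin'_apply, mulVec_transpose] at h2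
  rw [← h2, ENNReal.toReal_ofReal (abs_nonneg _), det_transpose, abs_inv]
  simp

/-- Integrability is preserved by the linear change of variables `v ↦ v ᵥ* A`. -/
theorem integrable_comp_vecMul {n : ℕ} {A : Matrix (Fin n) (Fin n) ℝ} (hA : IsUnit A.det)
    {g : (Fin n → ℝ) → ℂ} (hg : MeasureTheory.Integrable g) :
    MeasureTheory.Integrable fun v => g (v ᵥ* A) := by
  have hdet : Aᵀ.det ≠ 0 := by rw [det_transpose]; exact hA.ne_zero
  have h := Real.map_matrix_volume_pi_eq_smul_volume_pi hdet
  have h2 := (measurableEmbedding_toLin'_transpose hA).integrable_map_iff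
    (μ := MeasureTheory.volume) (g := g)
  rw [h] at h2
  have := h2.1 (hg.smul_measure ENNReal.ofReal_ne_top)
  simpa only [Function.comp_def, toLin'_apply, mulVec_transpose] using this

/-- The summand of the theta function of the lattice `ℤⁿ A`, as a function on `ℝⁿ`. -/
noncomputable def thetaKernel {n : ℕ} (A : Matrix (Fin n) (Fin n) ℝ) (t x y : Fin n → ℝ)
    (v : Fin n → ℝ) : ℂ :=
  cexp (-(1 / 2 : ℂ) * (∑ j, (x j + (v ᵥ* A) j) ^ 2 / t j : ℝ) +
    2 * π * I * ∑ j, (y j : ℂ) * ((x j + (v ᵥ* A) j : ℝ) : ℂ))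

theorem continuous_thetaKernel {n : ℕ} (A : Matrix (Fin n) (Fin n) ℝ) (t x y : Fin n → ℝ) :
    Continuous (thetaKernel A t x y) := by
  unfold thetaKernel
  simp only [vecMul, dotProduct]
  fun_prop

theorem norm_thetaKernel {n : ℕ} (A : Matrix (Fin n) (Fin n) ℝ) (t x y v : Fin n → ℝ) :
    ‖thetaKernel A t x y v‖ = rexp (-∑ j, (2 * t j)⁻¹ * (x j + (v ᵥ* A) j) ^ 2) := by
  have : -(1 / 2 : ℂ) * (∑ j, (x j + (v ᵥ* A) j) ^ 2 / t j : ℝ) +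
      2 * π * I * ∑ j, (y j : ℂ) * ((x j + (v ᵥ* A) j : ℝ) : ℂ) =
      ((-∑ j, (2 * t j)⁻¹ * (x j + (v ᵥ* A) j) ^ 2 : ℝ) : ℂ) +
        ((2 * π * ∑ j, y j * (x j + (v ᵥ* A) j) : ℝ) : ℂ) * I := by
    rw [← Finset.sum_neg_distrib]
    push_cast
    rw [Finset.mul_sum]
    congr 1
    · refine Finset.sum_congr rfl fun j _ => ?_
      rw [mul_inv]
      ring
    · ring
  rw [thetaKernel, this, Complex.exp_add, norm_mul, Complex.norm_exp_ofReal_mul_I, mul_one,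
    Complex.norm_exp_ofReal]

theorem dotProduct_dual_vecMul {n : ℕ} {A : Matrix (Fin n) (Fin n) ℝ} (hA : IsUnit A.det)
    (p v : Fin n → ℝ) : ∑ j, (p ᵥ* (Aᵀ)⁻¹) j * (v ᵥ* A) j = ∑ i, p i * v i := by
  change (p ᵥ* (Aᵀ)⁻¹) ⬝ᵥ (v ᵥ* A) = p ⬝ᵥ v
  rw [← mulVec_transpose A v, dotProduct_mulVec, vecMul_vecMul,
    nonsing_inv_mul _ (by rwa [det_transpose]), vecMul_one]

/-- The Gaussian integrand of the Fourier transform of `thetaKernel` in the coordinates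
`v ᵥ* A`, shifted by `x`. -/
theorem exp_mul_thetaKernel {n : ℕ} {A : Matrix (Fin n) (Fin n) ℝ} (hA : IsUnit A.det)
    (t x y : Fin n → ℝ) (p : Fin n → ℤ) (v : Fin n → ℝ) :
    cexp (-(2 * π * I * ∑ i, (p i : ℂ) * v i)) * thetaKernel A t x y v =
      cexp (2 * π * I * ∑ j, (x j : ℂ) * (((fun i => (p i : ℝ)) ᵥ* (Aᵀ)⁻¹) j : ℂ)) *
        cexp (-∑ j, ((2 * t j)⁻¹ : ℂ) * ((v ᵥ* A + x) j : ℂ) ^ 2 +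
          ∑ j, (2 * π * I * ((y j - ((fun i => (p i : ℝ)) ᵥ* (Aᵀ)⁻¹) j : ℝ) : ℂ)) *
            ((v ᵥ* A + x) j : ℂ)) := by
  have h := congrArg (fun r : ℝ => (r : ℂ)) (dotProduct_dual_vecMul hA (fun i => (p i : ℝ)) v)
  push_cast at h
  rw [thetaKernel, ← Complex.exp_add, ← Complex.exp_add, ← h]
  congr 1
  push_cast
  simp only [Finset.mul_sum, ← Finset.sum_neg_distrib, ← Finset.sum_add_distrib, Pi.add_apply]
  refine Finset.sum_congr rfl fun j _ => ?_
  rw [mul_inv]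
  push_cast
  ring

theorem integrable_gaussian {n : ℕ} {t : Fin n → ℝ} (ht : ∀ j, 0 < t j) (c : Fin n → ℂ) :
    MeasureTheory.Integrable fun u : Fin n → ℝ =>
      cexp (-∑ j, ((2 * t j)⁻¹ : ℂ) * (u j : ℂ) ^ 2 + ∑ j, c j * (u j : ℂ)) := by
  refine GaussianFourier.integrable_cexp_neg_sum_mul_add (fun j => ?_) c
  have := ht j
  norm_cast
  positivity

theorem integrable_thetaKernel {n : ℕ} {A : Matrix (Fin n) (Fin n) ℝ} (hA : IsUnit A.det)
    {t : Fin n → ℝ} (ht : ∀ j, 0 < t j) (x y : Fin n → ℝ) :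
    MeasureTheory.Integrable (thetaKernel A t x y) := by
  have h := (integrable_comp_vecMul hA ((integrable_gaussian ht
    fun j => 2 * π * I * ((y j - ((fun i => ((0 : ℤ) : ℝ)) ᵥ* (Aᵀ)⁻¹) j : ℝ) : ℂ)).comp_add_right
      x)).const_mul
    (cexp (2 * π * I * ∑ j, (x j : ℂ) * (((fun i => ((0 : ℤ) : ℝ)) ᵥ* (Aᵀ)⁻¹) j : ℂ)))
  refine h.congr (Filter.Eventually.of_forall fun v => ?_)
  simpa using (exp_mul_thetaKernel hA t x y 0 v).symm

theorem cpow_half_two_pi_mul {s : ℝ} (hs : 0 < s) :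
    (π / ((2 * s)⁻¹ : ℂ)) ^ (1 / 2 : ℂ) = ((√(2 * π) * √s : ℝ) : ℂ) := by
  rw [← Real.sqrt_mul (by positivity), Real.sqrt_eq_rpow, Complex.ofReal_cpow (by positivity)]
  congr 1
  · push_cast
    rw [div_inv_eq_mul]
    ring
  · push_cast
    rfl

theorem prod_sqrt_two_pi (n : ℕ) : ∏ _j : Fin n, √(2 * π) = (2 * π) ^ ((n : ℝ) / 2) := by
  rw [Finset.prod_const, Finset.card_univ, Fintype.card_fin, Real.sqrt_eq_rpow, ← Real.rpow_natCast,
    ← Real.rpow_mul (by positivity)]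
  congr 1
  ring

theorem intFourier_thetaKernel {n : ℕ} {A : Matrix (Fin n) (Fin n) ℝ} (hA : IsUnit A.det)
    {t : Fin n → ℝ} (ht : ∀ j, 0 < t j) (x y : Fin n → ℝ) (p : Fin n → ℤ) :
    intFourier (thetaKernel A t x y) p =
      (((2 * π) ^ ((n : ℝ) / 2) : ℝ) : ℂ) * ((|A.det| : ℝ) : ℂ)⁻¹ *
        ((∏ j, (√(t j) : ℂ)) *
          cexp (-(2 * (π : ℂ) ^ 2) *
            ∑ j, (((y j - ((fun i => (p i : ℝ)) ᵥ* (Aᵀ)⁻¹) j) ^ 2 * t j : ℝ) : ℂ) +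
              2 * π * I * ∑ j, (x j : ℂ) * (((fun i => (p i : ℝ)) ᵥ* (Aᵀ)⁻¹) j : ℂ))) := by
  simp only [intFourier, exp_mul_thetaKernel hA]
  set ξ := (fun i => (p i : ℝ)) ᵥ* (Aᵀ)⁻¹ with hξ
  rw [MeasureTheory.integral_const_mul, integral_comp_vecMul hA fun u : Fin n → ℝ =>
      cexp (-∑ j, ((2 * t j)⁻¹ : ℂ) * ((u + x) j : ℂ) ^ 2 +
        ∑ j, (2 * π * I * ((y j - ξ j : ℝ) : ℂ)) * ((u + x) j : ℂ)),
    MeasureTheory.integral_add_right_eq_self (fun u : Fin n → ℝ =>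
      cexp (-∑ j, ((2 * t j)⁻¹ : ℂ) * (u j : ℂ) ^ 2 +
        ∑ j, (2 * π * I * ((y j - ξ j : ℝ) : ℂ)) * (u j : ℂ))),
    GaussianFourier.integral_cexp_neg_sum_mul_add]
  · rw [Finset.prod_mul_distrib, ← Complex.exp_sum, Complex.exp_add,
      Finset.prod_congr rfl fun j _ => cpow_half_two_pi_mul (ht j), ← prod_sqrt_two_pi]
    have : ∑ j, (2 * π * I * ((y j - ξ j : ℝ) : ℂ)) ^ 2 / (4 * ((2 * t j)⁻¹ : ℂ)) =
        -(2 * (π : ℂ) ^ 2) * ∑ j, (((y j - ξ j) ^ 2 * t j : ℝ) : ℂ) := by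
      rw [Finset.mul_sum]
      refine Finset.sum_congr rfl fun j _ => ?_
      have : (t j : ℂ) ≠ 0 := by exact_mod_cast (ht j).ne'
      push_cast
      rw [mul_pow, mul_pow, I_sq]
      field_simp
      ring
    rw [this]
    push_cast
    rw [Finset.prod_mul_distrib]
    ring
  · intro j
    have := ht j
    norm_cast
    positivity

theorem summable_intFourier_thetaKernel {n : ℕ} {A : Matrix (Fin n) (Fin n) ℝ}
    (hA : IsUnit A.det) {t : Fin n → ℝ} (ht : ∀ j, 0 < t j) (x y : Fin n → ℝ) :
    Summable (intFourier (thetaKernel A t x y)) := by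
  have hB : IsUnit ((Aᵀ)⁻¹).det := by
    rw [det_nonsing_inv, det_transpose, Ring.inverse_eq_inv']
    exact hA.inv
  obtain ⟨u, hu, hub⟩ := exists_summable_gaussian_bound hB (s := fun j => 2 * π ^ 2 * t j)
    (fun j => by have := ht j; positivity) ‖-y‖
  refine Summable.of_norm_bounded (hu.mul_left
    ‖(((2 * π) ^ ((n : ℝ) / 2) : ℝ) : ℂ) * ((|A.det| : ℝ) : ℂ)⁻¹ * ∏ j, (√(t j) : ℂ)‖) fun p => ?_
  rw [intFourier_thetaKernel hA ht, ← mul_assoc, norm_mul]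
  refine mul_le_mul_of_nonneg_left ((le_of_eq ?_).trans (hub (-y) le_rfl p)) (norm_nonneg _)
  set ξ := (fun i => (p i : ℝ)) ᵥ* (Aᵀ)⁻¹
  have : -(2 * (π : ℂ) ^ 2) * ∑ j, (((y j - ξ j) ^ 2 * t j : ℝ) : ℂ) +
      2 * π * I * ∑ j, (x j : ℂ) * (ξ j : ℂ) =
      ((-∑ j, 2 * π ^ 2 * t j * ((-y) j + ξ j) ^ 2 : ℝ) : ℂ) +
        ((2 * π * ∑ j, x j * ξ j : ℝ) : ℂ) * I := by
    rw [← Finset.sum_neg_distrib]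
    push_cast
    rw [Finset.mul_sum]
    congr 1
    · refine Finset.sum_congr rfl fun j _ => ?_
      simp only [Pi.neg_apply]
      push_cast
      ring
    · ring
  rw [this, Complex.exp_add, norm_mul, Complex.norm_exp_ofReal_mul_I, mul_one,
    Complex.norm_exp_ofReal]

/-- Poisson summation for `thetaKernel`. -/
theorem tsum_thetaKernel {n : ℕ} {A : Matrix (Fin n) (Fin n) ℝ}
    (hA : IsUnit A.det) {t : Fin n → ℝ} (ht : ∀ j, 0 < t j) (x y v : Fin n → ℝ) :
    ∑' m : Fin n → ℤ, thetaKernel A t x y (v + fun i => (m i : ℝ)) =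
      ∑' p : Fin n → ℤ, intFourier (thetaKernel A t x y) p *
        cexp (2 * π * I * ∑ i, (p i : ℂ) * v i) := by
  refine tsum_int_translates_eq_tsum_intFourier (continuous_thetaKernel A t x y)
    (integrable_thetaKernel hA ht x y) (fun R => ?_) (summable_intFourier_thetaKernel hA ht x y) v
  let L := LinearMap.toContinuousLinearMap (Matrix.vecMulLinear A)
  obtain ⟨u, hu, hub⟩ := exists_summable_gaussian_bound hA (s := fun j => (2 * t j)⁻¹)
    (fun j => by have := ht j; positivity) (‖x‖ + ‖L‖ * R)
  refine ⟨u, hu, fun w hw m => ?_⟩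
  rw [norm_thetaKernel]
  have hL : ‖x + w ᵥ* A‖ ≤ ‖x‖ + ‖L‖ * R := by
    refine (norm_add_le _ _).trans (add_le_add_right ?_ _)
    exact (L.le_opNorm w).trans (by gcongr)
  simpa [add_vecMul, add_assoc] using hub (x + w ᵥ* A) hL m

/-- Division with remainder by `q` in each coordinate of `ℤⁿ`. -/
def piDivModEquiv (n q : ℕ) [NeZero q] : (Fin n → Fin q) × (Fin n → ℤ) ≃ (Fin n → ℤ) :=
  ((Equiv.piCongrRight fun _ => Int.divModEquiv q).trans
    ((Equiv.arrowProdEquivProdArrow _ _ _).trans (Equiv.prodComm _ _))).symm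

theorem piDivModEquiv_apply {n q : ℕ} [NeZero q] (a : Fin n → Fin q) (m : Fin n → ℤ) (i : Fin n) :
    piDivModEquiv n q (a, m) i = m i * q + ((a i : ℕ) : ℤ) := rfl

theorem summable_char_mul_thetaKernel {n q : ℕ} [NeZero q] (χ : Fin n → DirichletCharacter ℂ q)
    {A : Matrix (Fin n) (Fin n) ℝ} (hA : IsUnit A.det) {t : Fin n → ℝ} (ht : ∀ j, 0 < t j)
    (x y : Fin n → ℝ) :
    Summable fun k : Fin n → ℤ =>
      (∏ j, χ j (k j : ZMod q)) * thetaKernel A t x y (fun i => (k i : ℝ) / q) := by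
  have hq : (q : ℝ) ≠ 0 := Nat.cast_ne_zero.2 (NeZero.ne q)
  have hB : IsUnit ((q : ℝ)⁻¹ • A).det := by
    rw [det_smul]
    exact ((IsUnit.mk0 _ (inv_ne_zero hq)).pow _).mul hA
  obtain ⟨u, hu, hub⟩ := exists_summable_gaussian_bound hB (s := fun j => (2 * t j)⁻¹)
    (fun j => by have := ht j; positivity) ‖x‖
  refine Summable.of_norm_bounded hu fun k => ?_
  have h1 : ‖∏ j, χ j (k j : ZMod q)‖ ≤ 1 := by
    rw [norm_prod]
    exact Finset.prod_le_one (fun _ _ => norm_nonneg _) fun j _ => (χ j).norm_le_one _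
  have h2 : (fun i => (k i : ℝ) / q) ᵥ* A = (fun i => (k i : ℝ)) ᵥ* ((q : ℝ)⁻¹ • A) := by
    rw [vecMul_smul, ← smul_vecMul]
    congr 1
    ext i
    simp [div_eq_inv_mul]
  rw [norm_mul, norm_thetaKernel, h2]
  exact (mul_le_of_le_one_left (Real.exp_pos _).le h1).trans (hub x le_rfl k)

/-- The multidimensional finite Fourier transform of a product of primitive characters. -/
theorem sum_prod_char_mul_exp {n q : ℕ} [NeZero q] {χ : Fin n → DirichletCharacter ℂ q}
    (hχ : ∀ j, (χ j).IsPrimitive) (p : Fin n → ℤ) :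
    ∑ a : Fin n → Fin q, (∏ j, χ j ((a j : ℕ) : ZMod q)) *
        cexp (2 * π * I * ∑ j, (p j : ℂ) * ((((a j : ℕ) : ℝ) / (q : ℝ) : ℝ) : ℂ)) =
      (∏ j, (starRingEnd ℂ) (χ j (p j : ZMod q))) * ∏ j, gaussSumChar (χ j) := by
  simp only [Finset.mul_sum, Complex.exp_sum, ← Finset.prod_mul_distrib]
  rw [← Finset.prod_congr rfl fun j _ => sum_char_mul_exp (hχ j) (p j), Finset.prod_univ_sum,
    Fintype.piFinset_univ]

/-- Poisson summation for `thetaKernel` twisted by primitive characters. -/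
theorem tsum_char_mul_thetaKernel {n q : ℕ} [NeZero q] {χ : Fin n → DirichletCharacter ℂ q}
    (hχ : ∀ j, (χ j).IsPrimitive) {A : Matrix (Fin n) (Fin n) ℝ} (hA : IsUnit A.det)
    {t : Fin n → ℝ} (ht : ∀ j, 0 < t j) (x y : Fin n → ℝ) :
    ∑' k : Fin n → ℤ, (∏ j, χ j (k j : ZMod q)) * thetaKernel A t x y (fun i => (k i : ℝ) / q) =
      (∏ j, gaussSumChar (χ j)) * ∑' p : Fin n → ℤ,
        (∏ j, (starRingEnd ℂ) (χ j (p j : ZMod q))) * intFourier (thetaKernel A t x y) p := by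
  have hq : (q : ℝ) ≠ 0 := Nat.cast_ne_zero.2 (NeZero.ne q)
  have hs := summable_char_mul_thetaKernel χ hA ht x y
  rw [← (piDivModEquiv n q).tsum_eq]
  refine ((piDivModEquiv n q).summable_iff.2 hs).tsum_prod.trans ?_
  rw [tsum_fintype]
  simp only [Function.comp_apply]
  have hterm (a : Fin n → Fin q) :
      ∑' m : Fin n → ℤ, (∏ j, χ j ((piDivModEquiv n q (a, m) j : ℤ) : ZMod q)) *
        thetaKernel A t x y (fun i => (piDivModEquiv n q (a, m) i : ℝ) / q) =
      ∑' p : Fin n → ℤ, intFourier (thetaKernel A t x y) p *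
        ((∏ j, χ j ((a j : ℕ) : ZMod q)) *
          cexp (2 * π * I * ∑ j, (p j : ℂ) * ((((a j : ℕ) : ℝ) / (q : ℝ) : ℝ) : ℂ))) := by
    have h1 (m : Fin n → ℤ) : (fun i => (piDivModEquiv n q (a, m) i : ℝ) / q) =
        (fun i => ((a i : ℕ) : ℝ) / q) + fun i => (m i : ℝ) := by
      ext i
      rw [piDivModEquiv_apply, Pi.add_apply]
      push_cast
      field_simp
      ring
    simp only [h1]
    simp only [piDivModEquiv_apply, Int.cast_add, Int.cast_mul, Int.cast_natCast,
      ZMod.natCast_self, mul_zero, zero_add]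
    rw [tsum_mul_left, tsum_thetaKernel hA ht, ← tsum_mul_left]
    exact tsum_congr fun p => by ring
  rw [Finset.sum_congr rfl fun a _ => hterm a, ← Summable.tsum_finsetSum, ← tsum_mul_left]
  · refine tsum_congr fun p => ?_
    rw [← Finset.mul_sum, sum_prod_char_mul_exp hχ]
    ring
  · intro a _
    refine Summable.of_norm_bounded (summable_intFourier_thetaKernel hA ht x y).norm fun p => ?_
    rw [norm_mul, norm_mul]
    refine mul_le_of_le_one_right (norm_nonneg _) (mul_le_one₀ ?_ (norm_nonneg _) (le_of_eq ?_))
    · rw [norm_prod]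
      exact Finset.prod_le_one (fun _ _ => norm_nonneg _) fun j _ => (χ j).norm_le_one _
    · have := norm_cexp_neg_two_pi_I_sum (-p) (fun j => ((a j : ℕ) : ℝ) / (q : ℝ))
      simpa using this

/-- Corollary 1.2 of the paper (transformation formula of Riemann theta
functions with characters). For primitive Dirichlet characters `χ_1,…,χ_n` mod `q` and
a sublattice `Γ = ℤ^n A ⊆ ℤ^n` all entries of whose matrix `A` are integers divisible
by `q`, for any `t ∈ ℝ_{>0}^n`, `x ∈ ℤ^n`, `y ∈ ℝ^n`:
`(1/(2π)^{n/2}) Σ_{γ∈Γ} χ(γA⁻¹) exp(−(1/2)Σ_j (x_j+γ_j/q)²/t_j + 2πi⟨y,x+γ/q⟩)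
  = (∏_j G(χ_j)/vol(ℝ^n/Γ)) Σ_{γ*∈Γ*} χ̄(γ* ᵗA) (∏_j √t_j)
      exp(−2π² Σ_j (y_j−γ*_j)² t_j + 2πi⟨x,γ*⟩)`,
with `γ = k ᵥ* A` and `γ* = m ᵥ* (Aᵀ)⁻¹` for `k, m ∈ ℤ^n`. -/
theorem theta_transformation_with_characters (n q : ℕ) (hq : 1 ≤ q)
    (χ : Fin n → DirichletCharacter ℂ q) (hχ : ∀ j, (χ j).IsPrimitive)
    (A : Matrix (Fin n) (Fin n) ℝ) (hA : IsUnit A.det)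
    (hAq : ∀ i j, ∃ z : ℤ, A i j = (q : ℝ) * (z : ℝ))
    (t : Fin n → ℝ) (ht : ∀ j, 0 < t j) (x : Fin n → ℤ) (y : Fin n → ℝ) :
    (((2 * Real.pi) ^ ((n : ℝ) / 2) : ℝ) : ℂ)⁻¹ *
      ∑' k : Fin n → ℤ,
        (∏ j, (χ j) ((k j : ZMod q))) *
          Complex.exp (-(1 / 2 : ℂ) *
              ∑ j, (((x j : ℝ) + ((fun i => (k i : ℝ)) ᵥ* A) j / (q : ℝ)) ^ 2 / t j : ℝ) +
            2 * Real.pi * I *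
              ∑ j, (y j : ℂ) * (((x j : ℝ) + ((fun i => (k i : ℝ)) ᵥ* A) j / (q : ℝ) : ℝ) : ℂ)) =
    ((∏ j, gaussSumChar (χ j)) / ((|A.det| : ℝ) : ℂ)) *
      ∑' m : Fin n → ℤ,
        (∏ j, (starRingEnd ℂ) ((χ j) ((m j : ZMod q)))) *
          ((∏ j, (Real.sqrt (t j) : ℂ)) *
            Complex.exp (-(2 * (Real.pi : ℂ) ^ 2) *
                ∑ j, (((y j - ((fun i => (m i : ℝ)) ᵥ* (Aᵀ)⁻¹) j) ^ 2 * t j : ℝ) : ℂ) +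
              2 * Real.pi * I *
                ∑ j, (x j : ℂ) * (((fun i => (m i : ℝ)) ᵥ* (Aᵀ)⁻¹) j : ℂ))) := by
  have : NeZero q := ⟨by omega⟩
  have h := tsum_char_mul_thetaKernel hχ hA ht (fun j => (x j : ℝ)) y
  have h1 (k : Fin n → ℤ) (j : Fin n) :
      ((fun i => (k i : ℝ) / q) ᵥ* A) j = ((fun i => (k i : ℝ)) ᵥ* A) j / q := by
    rw [show (fun i => (k i : ℝ) / q) = (q : ℝ)⁻¹ • fun i => (k i : ℝ) by
      ext i; simp [div_eq_inv_mul], smul_vecMul, Pi.smul_apply, smul_eq_mul, div_eq_inv_mul]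
  have hpi : (((2 * π) ^ ((n : ℝ) / 2) : ℝ) : ℂ) ≠ 0 :=
    Complex.ofReal_ne_zero.2 (Real.rpow_pos_of_pos (by positivity) _).ne'
  simp only [thetaKernel, h1] at h
  rw [h, inv_mul_eq_iff_eq_mul₀ hpi, div_eq_mul_inv, ← tsum_mul_left, ← tsum_mul_left,
    ← tsum_mul_left]
  refine tsum_congr fun p => ?_
  have h2 := intFourier_thetaKernel hA ht (fun j => (x j : ℝ)) y p
  rw [h2]
  push_cast
  ring_nf
end

section
/- Let Γ be a lattice in ℝ^n. For (x,t) = ((x_j)_j,(t_j)_j) ∈ ℝ^n × ℂ^n, the series Σ_{γ=(γ_j)∈Γ} ∏_{j=1}^n ( Ĩ_{x_j+γ_j}(t_j) − e^{−t_j} sinc(π(x_j+γ_j)) ) converges absolutely, and the convergence is locally uniform in (x,t) ∈ ℝ^n × ℂ^n (i.e., uniform on every compact subset of ℝ^n × ℂ^n). -/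
open scoped Real
open Complex Matrix Filter

/-- The function `Ĩ_x(t) = (1/π) ∫₀^π e^{t cos θ} cos(xθ) dθ`. -/
noncomputable def besselItilde (x : ℝ) (t : ℂ) : ℂ :=
  (Real.pi : ℂ)⁻¹ * ∫ θ in (0:ℝ)..Real.pi, Complex.exp (t * Real.cos θ) * (Real.cos (x * θ) : ℂ)

/-- `sinc u = sin u / u` (with `sinc 0 = 1`), as a complex-valued function of a real
variable. -/
noncomputable def sinc (u : ℝ) : ℂ :=
  if u = 0 then 1 else (Real.sin u : ℂ) / (u : ℂ)

/-- The integral `∫₀^π cos(xθ) dθ` is `π sinc(πx)`. -/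
theorem integral_cos_mul_eq_pi_mul_sinc (x : ℝ) :
    ∫ θ in (0:ℝ)..Real.pi, (Real.cos (x * θ) : ℂ) = Real.pi * sinc (Real.pi * x) := by
  rw [intervalIntegral.integral_ofReal]
  by_cases hx : x = 0
  · simp [hx, sinc]
  · have hπ : (Real.pi : ℂ) ≠ 0 := by exact_mod_cast Real.pi_ne_zero
    have hx' : (x : ℂ) ≠ 0 := by exact_mod_cast hx
    rw [intervalIntegral.integral_comp_mul_left (fun u => Real.cos u) hx, sinc,
      if_neg (mul_ne_zero Real.pi_ne_zero hx)]
    simp only [mul_zero, integral_cos, Real.sin_zero, sub_zero, smul_eq_mul]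
    push_cast
    rw [mul_comm (x : ℂ) (Real.pi : ℂ)]
    field_simp

theorem besselItilde_sub_exp_mul_sinc (x : ℝ) (t : ℂ) :
    besselItilde x t - Complex.exp (-t) * sinc (Real.pi * x) =
      (Real.pi : ℂ)⁻¹ * ∫ θ in (0:ℝ)..Real.pi,
        (Complex.exp (t * Real.cos θ) - Complex.exp (-t)) * (Real.cos (x * θ) : ℂ) := by
  have hπ : (Real.pi : ℂ) ≠ 0 := by exact_mod_cast Real.pi_ne_zero
  simp only [sub_mul]
  rw [intervalIntegral.integral_sub
      (Continuous.intervalIntegrable (by fun_prop) _ _)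
      (Continuous.intervalIntegrable (by fun_prop) _ _),
    intervalIntegral.integral_const_mul, integral_cos_mul_eq_pi_mul_sinc, besselItilde]
  field_simp

/-- Integrating by parts twice; all boundary terms vanish. -/
theorem sq_mul_integral_exp_sub_exp_mul_cos (x : ℝ) (t : ℂ) :
    (x : ℂ) ^ 2 * ∫ θ in (0:ℝ)..Real.pi,
        (Complex.exp (t * Real.cos θ) - Complex.exp (-t)) * (Real.cos (x * θ) : ℂ) =
      ∫ θ in (0:ℝ)..Real.pi, (t * Real.cos θ - t ^ 2 * Real.sin θ ^ 2) *
        Complex.exp (t * Real.cos θ) * (Real.cos (x * θ) : ℂ) := by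
  rw [← intervalIntegral.integral_const_mul, ← sub_eq_zero,
    ← intervalIntegral.integral_sub
      (Continuous.intervalIntegrable (by fun_prop) _ _)
      (Continuous.intervalIntegrable (by fun_prop) _ _)]
  have hderiv : ∀ θ ∈ Set.uIcc (0:ℝ) Real.pi, HasDerivAt
      (fun θ : ℝ => (Complex.exp (t * Real.cos θ) - Complex.exp (-t)) *
          (x * (Real.sin (x * θ) : ℂ)) -
        t * Real.sin θ * Complex.exp (t * Real.cos θ) * (Real.cos (x * θ) : ℂ))
      ((x : ℂ) ^ 2 * ((Complex.exp (t * Real.cos θ) - Complex.exp (-t)) *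
          (Real.cos (x * θ) : ℂ)) -
        (t * Real.cos θ - t ^ 2 * Real.sin θ ^ 2) *
          Complex.exp (t * Real.cos θ) * (Real.cos (x * θ) : ℂ)) θ := by
    intro θ _
    have hc : HasDerivAt (fun θ : ℝ => (Real.cos θ : ℂ)) ((-Real.sin θ : ℝ) : ℂ) θ :=
      (Real.hasDerivAt_cos θ).ofReal_comp
    have hs : HasDerivAt (fun θ : ℝ => (Real.sin θ : ℂ)) ((Real.cos θ : ℝ) : ℂ) θ :=
      (Real.hasDerivAt_sin θ).ofReal_comp
    have hl : HasDerivAt (fun θ : ℝ => x * θ) x θ := by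
      simpa using (hasDerivAt_id θ).const_mul x
    have hcx : HasDerivAt (fun θ : ℝ => (Real.cos (x * θ) : ℂ))
        ((-Real.sin (x * θ) * x : ℝ) : ℂ) θ := hl.cos.ofReal_comp
    have hsx : HasDerivAt (fun θ : ℝ => (Real.sin (x * θ) : ℂ))
        ((Real.cos (x * θ) * x : ℝ) : ℂ) θ := hl.sin.ofReal_comp
    have he := (hc.const_mul t).cexp
    refine (((he.sub_const (Complex.exp (-t))).mul (hsx.const_mul (x : ℂ))).sub
      (((hs.const_mul t).mul he).mul hcx)).congr_deriv ?_
    simp only [Pi.mul_apply]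
    push_cast
    ring
  rw [intervalIntegral.integral_eq_sub_of_hasDerivAt hderiv
    (Continuous.intervalIntegrable (by fun_prop) _ _)]
  simp

theorem norm_exp_mul_cos_le {t : ℂ} {T : ℝ} (ht : ‖t‖ ≤ T) (θ : ℝ) :
    ‖Complex.exp (t * Real.cos θ)‖ ≤ Real.exp T := by
  refine (Complex.norm_exp_le_exp_norm _).trans (Real.exp_le_exp.2 ?_)
  rw [norm_mul, Complex.norm_real, Real.norm_eq_abs]
  exact (mul_le_of_le_one_right (norm_nonneg t) (Real.abs_cos_le_one θ)).trans ht

theorem norm_mul_cos_le (z : ℂ) (u : ℝ) : ‖z * (Real.cos u : ℂ)‖ ≤ ‖z‖ := by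
  rw [norm_mul, Complex.norm_real, Real.norm_eq_abs]
  exact mul_le_of_le_one_right (norm_nonneg z) (Real.abs_cos_le_one u)

/-- Quadratic decay of `Ĩ_x(t) - e^{-t} sinc(πx)` in `x`, uniformly for bounded `t`. -/
theorem norm_besselItilde_sub_le {t : ℂ} {T : ℝ} (ht : ‖t‖ ≤ T) (x : ℝ) :
    ‖besselItilde x t - Complex.exp (-t) * sinc (Real.pi * x)‖ ≤
      (2 + T + T ^ 2) * Real.exp T * (1 + x ^ 2)⁻¹ := by
  have hT : 0 ≤ T := (norm_nonneg t).trans ht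
  rw [besselItilde_sub_exp_mul_sinc, ← div_eq_mul_inv, le_div_iff₀ (by positivity)]
  set J := ∫ θ in (0:ℝ)..Real.pi,
    (Complex.exp (t * Real.cos θ) - Complex.exp (-t)) * (Real.cos (x * θ) : ℂ) with hJ
  have hbound : ‖J‖ ≤ 2 * Real.exp T * |Real.pi - 0| := by
    refine intervalIntegral.norm_integral_le_of_norm_le_const fun θ _ => ?_
    refine (norm_mul_cos_le _ _).trans ((norm_sub_le _ _).trans ?_)
    have h₁ := norm_exp_mul_cos_le ht θ
    have h₂ : ‖Complex.exp (-t)‖ ≤ Real.exp T :=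
      (Complex.norm_exp_le_exp_norm _).trans (Real.exp_le_exp.2 (by rwa [norm_neg]))
    linarith
  have hdecay : ‖(x : ℂ) ^ 2 * J‖ ≤ (T + T ^ 2) * Real.exp T * |Real.pi - 0| := by
    rw [hJ, sq_mul_integral_exp_sub_exp_mul_cos]
    refine intervalIntegral.norm_integral_le_of_norm_le_const fun θ _ => ?_
    refine (norm_mul_cos_le _ _).trans ?_
    rw [norm_mul]
    refine mul_le_mul ((norm_sub_le _ _).trans (add_le_add ?_ ?_))
      (norm_exp_mul_cos_le ht θ) (norm_nonneg _) (by positivity)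
    · exact (norm_mul_cos_le _ _).trans ht
    · rw [norm_mul, norm_pow, norm_pow, Complex.norm_real, Real.norm_eq_abs, sq_abs]
      refine (mul_le_of_le_one_right (by positivity) (Real.sin_sq_le_one θ)).trans ?_
      gcongr
  rw [norm_mul, norm_pow, Complex.norm_real, Real.norm_eq_abs, sq_abs] at hdecay
  rw [sub_zero, abs_of_pos Real.pi_pos] at hbound hdecay
  rw [norm_mul, norm_inv, Complex.norm_real, Real.norm_eq_abs, abs_of_pos Real.pi_pos,
    mul_assoc, inv_mul_le_iff₀ Real.pi_pos]
  linarith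

/-- A product of nonnegative summable functions of separate variables is summable. -/
theorem summable_prod_apply_of_nonneg {ι α : Type*} [Fintype ι] {g : α → ℝ}
    (hg : ∀ a, 0 ≤ g a) (hs : Summable g) : Summable fun m : ι → α => ∏ j, g (m j) := by
  classical
  refine summable_of_sum_le (c := ∏ _j : ι, ∑' a, g a)
    (fun m => Finset.prod_nonneg fun j _ => hg _) fun s => ?_
  calc ∑ m ∈ s, ∏ j, g (m j)
      ≤ ∑ m ∈ Fintype.piFinset fun j => s.image fun m => m j, ∏ j, g (m j) := by
        refine Finset.sum_le_sum_of_subset_of_nonneg (fun m hm => ?_)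
          fun m _ _ => Finset.prod_nonneg fun j _ => hg _
        exact Fintype.mem_piFinset.2 fun j => Finset.mem_image_of_mem _ hm
    _ = ∏ j, ∑ a ∈ s.image fun m => m j, g a := (Finset.prod_univ_sum _ _).symm
    _ ≤ ∏ _j : ι, ∑' a, g a :=
        Finset.prod_le_prod (fun j _ => Finset.sum_nonneg fun a _ => hg a)
          fun j _ => hs.sum_le_tsum _ fun a _ => hg a

theorem summable_inv_one_add_sq_int : Summable fun m : ℤ => (1 + (m : ℝ) ^ 2)⁻¹ := by
  refine Summable.of_norm_bounded_eventually
    (Real.summable_one_div_int_pow.2 (by norm_num : 1 < 2)) ?_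
  filter_upwards [(Set.finite_singleton (0 : ℤ)).compl_mem_cofinite] with m hm
  have hm' : (m : ℝ) ≠ 0 := by exact_mod_cast hm
  rw [Real.norm_of_nonneg (by positivity), one_div]
  exact inv_anti₀ (by positivity) (by linarith)

/-- After sufficient dilation, distinct lattice points have distinct integer parts. -/
theorem exists_injective_floor_mul_vecMul {ι : Type*} [Fintype ι] [DecidableEq ι]
    (A : Matrix ι ι ℝ) (hA : IsUnit A.det) :
    ∃ M : ℝ, 0 < M ∧ Function.Injective fun (k : ι → ℤ) (j : ι) =>
      ⌊M * ((fun i => (k i : ℝ)) ᵥ* A) j⌋ := by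
  set M : ℝ := 1 + ∑ i, ∑ j, |A⁻¹ j i| with hM
  have hMpos : 0 < M := by positivity
  refine ⟨M, hMpos, fun k l hkl => funext fun i => ?_⟩
  set v : ι → ℝ := (fun i => (k i : ℝ) - l i) ᵥ* A with hv
  have hvlt : ∀ j, |M * v j| < 1 := fun j => by
    have h := Int.abs_sub_lt_one_of_floor_eq_floor (congrFun hkl j)
    have hsub : v = (fun i => (k i : ℝ)) ᵥ* A - (fun i => (l i : ℝ)) ᵥ* A := by
      rw [← Matrix.sub_vecMul]; rfl
    rwa [hsub, Pi.sub_apply, mul_sub]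
  have hinv : (k i : ℝ) - l i = ∑ j, v j * A⁻¹ j i := by
    have h : v ᵥ* A⁻¹ = fun i => (k i : ℝ) - l i := by
      rw [hv, Matrix.vecMul_vecMul, Matrix.mul_nonsing_inv _ hA, Matrix.vecMul_one]
    exact (congrFun h i).symm
  have hlt : M * |(k i : ℝ) - l i| < M := by
    calc M * |(k i : ℝ) - l i| = |∑ j, M * v j * A⁻¹ j i| := by
          rw [← abs_of_pos hMpos, ← abs_mul, abs_of_pos hMpos, hinv, Finset.mul_sum]
          simp only [mul_assoc]
      _ ≤ ∑ j, |M * v j| * |A⁻¹ j i| := by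
          simpa only [abs_mul] using
            Finset.abs_sum_le_sum_abs (fun j => M * v j * A⁻¹ j i) Finset.univ
      _ ≤ ∑ j, |A⁻¹ j i| := Finset.sum_le_sum fun j _ =>
          mul_le_of_le_one_left (abs_nonneg _) (hvlt j).le
      _ ≤ ∑ i, ∑ j, |A⁻¹ j i| :=
          Finset.single_le_sum (f := fun i => ∑ j, |A⁻¹ j i|)
            (fun i _ => Finset.sum_nonneg fun j _ => abs_nonneg _) (Finset.mem_univ i)
      _ < M := by linarith
  have hone : |(k i : ℝ) - l i| < 1 := by
    by_contra! h
    nlinarith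
  have hint : |k i - l i| < 1 := by exact_mod_cast hone
  exact sub_eq_zero.1 (Int.abs_lt_one_iff.1 hint)

theorem inv_one_add_add_sq_le {M R x : ℝ} (hM : 0 < M) (hx : |x| ≤ R) (y : ℝ) :
    (1 + (x + y) ^ 2)⁻¹ ≤
      (1 + 2 * M ^ 2 + 2 * (M * R + 1) ^ 2) * (1 + (⌊M * y⌋ : ℝ) ^ 2)⁻¹ := by
  have habs : |(⌊M * y⌋ : ℝ)| ≤ M * |x + y| + (M * R + 1) := by
    have h₁ : |(⌊M * y⌋ : ℝ) - M * y| ≤ 1 := by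
      rw [abs_le]
      constructor <;> linarith [Int.floor_le (M * y), Int.lt_floor_add_one (M * y)]
    have h₂ : |y| ≤ |x + y| + |x| := by simpa using abs_sub (x + y) x
    calc |(⌊M * y⌋ : ℝ)| = |((⌊M * y⌋ : ℝ) - M * y) + M * y| := by rw [sub_add_cancel]
      _ ≤ |(⌊M * y⌋ : ℝ) - M * y| + |M * y| := abs_add_le _ _
      _ = |(⌊M * y⌋ : ℝ) - M * y| + M * |y| := by rw [abs_mul, abs_of_pos hM]
      _ ≤ 1 + M * (|x + y| + R) := by gcongr; linarith
      _ = M * |x + y| + (M * R + 1) := by ring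
  have hsq : (⌊M * y⌋ : ℝ) ^ 2 ≤ 2 * M ^ 2 * (x + y) ^ 2 + 2 * (M * R + 1) ^ 2 := by
    have h := pow_le_pow_left₀ (abs_nonneg _) habs 2
    rw [sq_abs] at h
    have h' := add_sq_le (a := M * |x + y|) (b := M * R + 1)
    rw [mul_pow, sq_abs] at h'
    linarith
  rw [← div_eq_mul_inv, le_div_iff₀ (by positivity), inv_mul_le_iff₀ (by positivity)]
  nlinarith [sq_nonneg M, sq_nonneg (x + y),
    mul_nonneg (sq_nonneg (M * R + 1)) (sq_nonneg (x + y))]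

/-- A summable majorant of the lattice series on the region `‖x‖, ‖t‖ ≤ R`. -/
theorem exists_summable_bound_prod_besselItilde_sub {n : ℕ} (A : Matrix (Fin n) (Fin n) ℝ)
    (hA : IsUnit A.det) (R : ℝ) :
    ∃ u : (Fin n → ℤ) → ℝ, Summable u ∧ ∀ (k : Fin n → ℤ) (x : Fin n → ℝ) (t : Fin n → ℂ),
      ‖x‖ ≤ R → ‖t‖ ≤ R →
      ‖∏ j, (besselItilde (x j + ((fun i => (k i : ℝ)) ᵥ* A) j) (t j) -
          Complex.exp (-(t j)) * sinc (Real.pi * (x j + ((fun i => (k i : ℝ)) ᵥ* A) j)))‖ ≤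
        u k := by
  obtain ⟨M, hM, hinj⟩ := exists_injective_floor_mul_vecMul A hA
  set B := (2 + R + R ^ 2) * Real.exp R
  set C := 1 + 2 * M ^ 2 + 2 * (M * R + 1) ^ 2
  have hsum := ((summable_prod_apply_of_nonneg (ι := Fin n) (fun m : ℤ => by positivity)
    summable_inv_one_add_sq_int).comp_injective hinj).mul_left ((B * C) ^ n)
  refine ⟨_, hsum, fun k x t hx ht => ?_⟩
  have hR : 0 ≤ R := (norm_nonneg x).trans hx
  have hB0 : 0 ≤ B := by positivity
  calc _ ≤ ∏ j, B * C * (1 + (⌊M * ((fun i => (k i : ℝ)) ᵥ* A) j⌋ : ℝ) ^ 2)⁻¹ := by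
        rw [norm_prod]
        refine Finset.prod_le_prod (fun j _ => norm_nonneg _) fun j _ => ?_
        refine (norm_besselItilde_sub_le ((norm_le_pi_norm t j).trans ht) _).trans ?_
        rw [mul_assoc B C]
        exact mul_le_mul_of_nonneg_left
          (inv_one_add_add_sq_le hM ((norm_le_pi_norm x j).trans hx) _) hB0
    _ = _ := by simp [Finset.prod_mul_distrib]

/-- first part of Lemma 2.4 of the paper: for a lattice `Γ = ℤ^n A`
(`A ∈ GL_n(ℝ)`), the series
`Σ_{γ∈Γ} ∏_j (Ĩ_{x_j+γ_j}(t_j) − e^{−t_j} sinc(π(x_j+γ_j)))`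
converges absolutely for every `(x,t) ∈ ℝ^n × ℂ^n`, and the convergence is locally
uniform, i.e. the net of partial sums converges uniformly on every compact subset of
`ℝ^n × ℂ^n`. -/
theorem besselItilde_sum_locally_uniform_convergence (n : ℕ)
    (A : Matrix (Fin n) (Fin n) ℝ) (hA : IsUnit A.det) :
    (∀ (x : Fin n → ℝ) (t : Fin n → ℂ),
      Summable fun k : Fin n → ℤ =>
        ‖∏ j, (besselItilde (x j + ((fun i => (k i : ℝ)) ᵥ* A) j) (t j) -
            Complex.exp (-(t j)) * sinc (Real.pi * (x j + ((fun i => (k i : ℝ)) ᵥ* A) j)))‖) ∧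
    (∀ K : Set ((Fin n → ℝ) × (Fin n → ℂ)), IsCompact K →
      TendstoUniformlyOn
        (fun (s : Finset (Fin n → ℤ)) (p : (Fin n → ℝ) × (Fin n → ℂ)) =>
          ∑ k ∈ s, ∏ j, (besselItilde (p.1 j + ((fun i => (k i : ℝ)) ᵥ* A) j) (p.2 j) -
            Complex.exp (-(p.2 j)) * sinc (Real.pi * (p.1 j + ((fun i => (k i : ℝ)) ᵥ* A) j))))
        (fun p => ∑' k : Fin n → ℤ,
          ∏ j, (besselItilde (p.1 j + ((fun i => (k i : ℝ)) ᵥ* A) j) (p.2 j) -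
            Complex.exp (-(p.2 j)) * sinc (Real.pi * (p.1 j + ((fun i => (k i : ℝ)) ᵥ* A) j))))
        atTop K) := by
  refine ⟨fun x t => ?_, fun K hK => ?_⟩
  · obtain ⟨u, hu, hbound⟩ := exists_summable_bound_prod_besselItilde_sub A hA (max ‖x‖ ‖t‖)
    exact Summable.of_nonneg_of_le (fun k => norm_nonneg _)
      (fun k => hbound k x t (le_max_left _ _) (le_max_right _ _)) hu
  · obtain ⟨R, hR⟩ := hK.isBounded.exists_norm_le
    obtain ⟨u, hu, hbound⟩ := exists_summable_bound_prod_besselItilde_sub A hA R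
    exact tendstoUniformlyOn_tsum hu fun k p hp =>
      hbound k p.1 p.2 ((norm_fst_le p).trans (hR p hp)) ((norm_snd_le p).trans (hR p hp))
end

section
/- Let q be a positive integer and c : ℤ^n → ℂ a function satisfying c(a_1+q,…,a_n+q') = c(a) componentwise with period q in each coordinate (so c factors through (ℤ/qℤ)^n), and let ĉ(m) = Σ_{a∈(ℤ/qℤ)^n} c(a) e^{2πi⟨a/q, m⟩} for m ∈ ℤ^n be its discrete Fourier transform. Let Γ = ℤ^n A be a lattice in ℝ^n and let f : ℝ^n → ℂ be an L¹-function such that (i) Σ_{γ∈Γ} f(x+γ) converges absolutely and is continuous in x ∈ ℝ^n, and (ii) Σ_{γ*∈Γ*} f̂(γ*) converges absolutely. Then for all x ∈ ℝ^n: Σ_{γ∈Γ} c(γA^{-1}) f(x + γ/q) = (1/|det A|) Σ_{γ*∈Γ*} ĉ(γ* ᵗA) f̂(γ*) e^{2πi⟨x,γ*⟩}. -/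
open scoped Real
open Complex Matrix MeasureTheory

/-- Translation invariance of the integral for the unit boxes with integer corners. -/
theorem setIntegral_pi_Ioc_add_int {d : Type*} [Fintype d] {E : Type*}
    [NormedAddCommGroup E] [NormedSpace ℝ E] (h : (d → ℝ) → E) (k : d → ℤ) :
    ∫ x in {x : d → ℝ | ∀ i, x i ∈ Set.Ioc (k i : ℝ) (k i + 1)}, h x =
      ∫ x in {x : d → ℝ | ∀ i, x i ∈ Set.Ioc (0 : ℝ) (0 + 1)}, h (x + fun i => (k i : ℝ)) := by
  rw [← (measurePreserving_add_right volume (fun i => (k i : ℝ))).setIntegral_preimage_emb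
    (measurableEmbedding_addRight _)]
  congr 2
  ext x
  simp [add_comm _ (1 : ℝ)]

/-- The integral of an integrable function over `ℝ^d` is the integral over the unit box of its
periodization. -/
theorem integral_eq_setIntegral_tsum_add_int {d : Type*} [Fintype d] {E : Type*}
    [NormedAddCommGroup E] [NormedSpace ℝ E] {g : (d → ℝ) → E} (hg : Integrable g) :
    ∫ x, g x = ∫ x in {x : d → ℝ | ∀ i, x i ∈ Set.Ioc (0 : ℝ) (0 + 1)},
      ∑' k : d → ℤ, g (x + fun i => (k i : ℝ)) := by
  set S : (d → ℤ) → Set (d → ℝ) := fun k => {x | ∀ i, x i ∈ Set.Ioc (k i : ℝ) (k i + 1)} with hS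
  have hmeas : ∀ k, MeasurableSet (S k) := fun k =>
    MeasurableSet.univ_pi' (fun i => measurableSet_Ioc)
  have hdisj : Pairwise (Function.onFun Disjoint S) := by
    intro k l hkl
    refine Set.disjoint_left.2 fun x hx hy => hkl (funext fun i => ?_)
    have h1 := hx i
    have h2 := hy i
    have h3 : (k i : ℝ) < l i + 1 := h1.1.trans_le h2.2
    have h4 : (l i : ℝ) < k i + 1 := h2.1.trans_le h1.2
    norm_cast at h3 h4
    omega
  have hunion : ⋃ k, S k = Set.univ := by
    refine Set.eq_univ_of_forall fun x => Set.mem_iUnion.2 ⟨fun i => ⌈x i⌉ - 1, fun i => ?_⟩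
    have h1 := Int.le_ceil (x i)
    have h2 := Int.ceil_lt_add_one (x i)
    push_cast
    constructor <;> linarith
  rw [← setIntegral_univ, ← hunion, integral_iUnion hmeas hdisj (by simpa [hunion] using hg)]
  simp_rw [hS, setIntegral_pi_Ioc_add_int g]
  refine integral_tsum_of_summable_integral_norm
    (fun k => (hg.comp_add_right _).integrableOn) ?_
  simp_rw [← setIntegral_pi_Ioc_add_int fun x => ‖g x‖]
  exact (hasSum_integral_iUnion hmeas hdisj (by simpa [hunion] using hg.norm)).summable

/-- The Fourier monomials of the unit torus, evaluated at the class of a real vector. -/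
theorem UnitAddTorus.mFourier_coe_apply {d : Type*} [Fintype d] (m : d → ℤ) (x : d → ℝ) :
    mFourier m (fun i => (x i : UnitAddCircle)) =
      Complex.exp (2 * Real.pi * I * ∑ j, (x j : ℂ) * (m j : ℂ)) := by
  simp only [mFourier, ContinuousMap.coe_mk, fourier_coe_apply, Finset.mul_sum, Complex.exp_sum]
  refine Finset.prod_congr rfl fun i _ => ?_
  congr 1
  push_cast
  ring

/-- A continuous function on `ℝ^d` that is invariant under integer translations descends to the
unit torus. -/
theorem UnitAddTorus.exists_continuousMap_of_periodic {d : Type*} [Fintype d] {E : Type*}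
    [TopologicalSpace E] {F : (d → ℝ) → E} (hF : Continuous F)
    (hper : ∀ (x : d → ℝ) (k : d → ℤ), F (x + fun i => (k i : ℝ)) = F x) :
    ∃ G : C(UnitAddTorus d, E), ∀ x : d → ℝ, G (fun i => (x i : UnitAddCircle)) = F x := by
  have hquot : IsOpenQuotientMap
      (Pi.map fun (_ : d) (t : ℝ) => (t : UnitAddCircle)) :=
    IsOpenQuotientMap.piMap fun _ => QuotientAddGroup.isOpenQuotientMap_mk
  have hfac : ∀ x : d → ℝ,
      F (fun i => (AddCircle.equivIoc (1 : ℝ) 0 (x i : UnitAddCircle) : ℝ)) = F x := by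
    intro x
    have h : ∀ i, ∃ k : ℤ, x i + k = AddCircle.equivIoc (1 : ℝ) 0 (x i : UnitAddCircle) := by
      intro i
      have h1 : ((AddCircle.equivIoc (1 : ℝ) 0 (x i : UnitAddCircle) : ℝ) : UnitAddCircle) = x i :=
        (AddCircle.equivIoc (1 : ℝ) 0).left_inv _
      obtain ⟨k, hk⟩ := AddSubgroup.mem_zmultiples_iff.1 (QuotientAddGroup.eq.1 h1.symm)
      exact ⟨k, by simp at hk; linarith⟩
    choose k hk using h
    rw [← hper x k]
    congr 1
    ext i
    exact (hk i).symm
  refine ⟨⟨fun t => F (fun i => (AddCircle.equivIoc (1 : ℝ) 0 (t i) : ℝ)), ?_⟩, hfac⟩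
  rw [hquot.isQuotientMap.continuous_iff]
  convert hF using 1
  ext x
  exact hfac x

/-- Poisson summation for the lattice `ℤ^d` and an integrable function with continuous
periodization and absolutely summable Fourier transform on `ℤ^d`. -/
theorem hasSum_poisson_pi_int {d : Type*} [Fintype d] {g : (d → ℝ) → ℂ} (hg : Integrable g)
    (hcont : Continuous fun x : d → ℝ => ∑' k : d → ℤ, g (x + fun i => (k i : ℝ)))
    (hsum : Summable fun m : d → ℤ =>
      ∫ z : d → ℝ, g z * Complex.exp (-(2 * Real.pi * I * ∑ j, (z j : ℂ) * (m j : ℂ))))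
    (x : d → ℝ) :
    HasSum (fun m : d → ℤ =>
      (∫ z : d → ℝ, g z * Complex.exp (-(2 * Real.pi * I * ∑ j, (z j : ℂ) * (m j : ℂ)))) *
        Complex.exp (2 * Real.pi * I * ∑ j, (x j : ℂ) * (m j : ℂ)))
      (∑' k : d → ℤ, g (x + fun i => (k i : ℝ))) := by
  have hper : ∀ (x : d → ℝ) (l : d → ℤ),
      ∑' k : d → ℤ, g ((x + fun i => (l i : ℝ)) + fun i => (k i : ℝ)) =
        ∑' k : d → ℤ, g (x + fun i => (k i : ℝ)) := by
    intro x l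
    rw [← (Equiv.addLeft l).tsum_eq (fun k : d → ℤ => g (x + fun i => (k i : ℝ)))]
    refine tsum_congr fun k => congrArg g ?_
    ext i
    simp [add_assoc]
  obtain ⟨G, hG⟩ := UnitAddTorus.exists_continuousMap_of_periodic hcont hper
  have hcoeff : ∀ m : d → ℤ, UnitAddTorus.mFourierCoeff G m =
      ∫ z : d → ℝ, g z * Complex.exp (-(2 * Real.pi * I * ∑ j, (z j : ℂ) * (m j : ℂ))) := by
    intro m
    rw [integral_eq_setIntegral_tsum_add_int, UnitAddTorus.mFourierCoeff_eq_integral _ _ fun _ => 0]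
    · refine integral_congr_ae (Filter.Eventually.of_forall fun z => ?_)
      simp only [hG, smul_eq_mul, UnitAddTorus.mFourier_coe_apply]
      rw [← tsum_mul_left]
      refine tsum_congr fun k => ?_
      rw [mul_comm]
      congr 1
      rw [Complex.exp_eq_exp_iff_exists_int]
      refine ⟨∑ j, k j * m j, ?_⟩
      push_cast [Pi.add_apply, Pi.neg_apply, add_mul, Finset.sum_add_distrib, Finset.sum_neg_distrib]
      simp only [mul_neg, Finset.sum_neg_distrib]
      ring
    · refine hg.mul_bdd (c := 1) (Continuous.aestronglyMeasurable (by fun_prop))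
        (Filter.Eventually.of_forall fun z => ?_)
      rw [Complex.norm_exp]
      simp [← Complex.ofReal_intCast, ← Complex.ofReal_mul, ← Complex.ofReal_sum]
  have h := UnitAddTorus.hasSum_mFourier_series_apply_of_summable (f := G)
    (by simpa only [← hcoeff] using hsum) (fun i => (x i : UnitAddCircle))
  simpa only [hcoeff, hG, UnitAddTorus.mFourier_coe_apply, smul_eq_mul] using h

/-- The pairing of `y A` with `m (Aᵀ)⁻¹` is the pairing of `y` with `m`. -/
theorem sum_vecMul_mul_vecMul_transpose_inv {d : Type*} [Fintype d] [DecidableEq d]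
    {A : Matrix d d ℝ} (hA : IsUnit A.det) (y : d → ℝ) (m : d → ℤ) :
    ∑ j, (((y ᵥ* A) j : ℝ) : ℂ) * (((fun i => (m i : ℝ)) ᵥ* (Aᵀ)⁻¹) j : ℂ) =
      ∑ j, (y j : ℂ) * (m j : ℂ) := by
  have h : (y ᵥ* A) ⬝ᵥ ((fun i => (m i : ℝ)) ᵥ* (Aᵀ)⁻¹) = y ⬝ᵥ (fun i => (m i : ℝ)) := by
    rw [← Matrix.transpose_nonsing_inv, Matrix.vecMul_transpose, ← Matrix.dotProduct_mulVec,
      Matrix.mulVec_mulVec, Matrix.mul_nonsing_inv _ hA, Matrix.one_mulVec]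
  simp only [dotProduct] at h
  exact_mod_cast h

/-- Poisson summation for the lattice `ℤ^d A`. -/
theorem hasSum_poisson_lattice {d : Type*} [Fintype d] [DecidableEq d] {A : Matrix d d ℝ}
    (hA : IsUnit A.det) {f : (d → ℝ) → ℂ} (hf : Integrable f)
    (hcont : Continuous fun x : d → ℝ => ∑' k : d → ℤ, f (x + (fun i => (k i : ℝ)) ᵥ* A))
    (hsum : Summable fun m : d → ℤ => ∫ z : d → ℝ, f z * Complex.exp (-(2 * Real.pi * I *
      ∑ j, (z j : ℂ) * (((fun i => (m i : ℝ)) ᵥ* (Aᵀ)⁻¹) j : ℂ))))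
    (x : d → ℝ) :
    HasSum (fun m : d → ℤ =>
      ((|A.det| : ℝ) : ℂ)⁻¹ * ((∫ z : d → ℝ, f z * Complex.exp (-(2 * Real.pi * I *
        ∑ j, (z j : ℂ) * (((fun i => (m i : ℝ)) ᵥ* (Aᵀ)⁻¹) j : ℂ)))) *
      Complex.exp (2 * Real.pi * I *
        ∑ j, (x j : ℂ) * (((fun i => (m i : ℝ)) ᵥ* (Aᵀ)⁻¹) j : ℂ))))
      (∑' k : d → ℤ, f (x + (fun i => (k i : ℝ)) ᵥ* A)) := by
  have hdet : A.det ≠ 0 := hA.ne_zero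
  have hmap : Measure.map (fun y : d → ℝ => y ᵥ* A) volume =
      ENNReal.ofReal |A.det|⁻¹ • volume := by
    have h := Real.map_matrix_volume_pi_eq_smul_volume_pi (M := Aᵀ) (by simpa using hdet)
    have h2 : (toLin' Aᵀ : (d → ℝ) → (d → ℝ)) = fun y => y ᵥ* A := by
      ext1 y
      simp [Matrix.mulVec_transpose]
    rwa [h2, Matrix.det_transpose, abs_inv] at h
  have hcontA : Continuous fun y : d → ℝ => y ᵥ* A := by fun_prop
  have hg : Integrable fun y : d → ℝ => f (y ᵥ* A) := by
    refine Integrable.comp_measurable ?_ hcontA.measurable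
    rw [hmap]
    exact hf.smul_measure ENNReal.ofReal_ne_top
  have hint : ∀ m : d → ℤ,
      ∫ y : d → ℝ, f (y ᵥ* A) * Complex.exp (-(2 * Real.pi * I * ∑ j, (y j : ℂ) * (m j : ℂ))) =
        ((|A.det| : ℝ) : ℂ)⁻¹ * ∫ z : d → ℝ, f z * Complex.exp (-(2 * Real.pi * I *
          ∑ j, (z j : ℂ) * (((fun i => (m i : ℝ)) ᵥ* (Aᵀ)⁻¹) j : ℂ))) := by
    intro m
    have h := integral_map (μ := volume) hcontA.aemeasurable
      (f := fun z : d → ℝ => f z * Complex.exp (-(2 * Real.pi * I *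
        ∑ j, (z j : ℂ) * (((fun i => (m i : ℝ)) ᵥ* (Aᵀ)⁻¹) j : ℂ)))) (by
        rw [hmap]
        exact (hf.aestronglyMeasurable.mul
          (Continuous.aestronglyMeasurable (by fun_prop))).smul_measure _)
    simp only [sum_vecMul_mul_vecMul_transpose_inv hA] at h
    rw [← h, hmap, integral_smul_measure, ENNReal.toReal_ofReal (by positivity), Complex.real_smul,
      Complex.ofReal_inv]
  have hx : (x ᵥ* A⁻¹) ᵥ* A = x := by
    rw [Matrix.vecMul_vecMul, Matrix.nonsing_inv_mul _ hA, Matrix.vecMul_one]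
  have h := hasSum_poisson_pi_int hg
    (by simpa only [Matrix.add_vecMul, Function.comp_def] using hcont.comp hcontA)
    (by simpa only [hint] using hsum.mul_left _) (x ᵥ* A⁻¹)
  simp only [hint, ← sum_vecMul_mul_vecMul_transpose_inv hA (x ᵥ* A⁻¹), Matrix.add_vecMul, hx] at h
  simpa only [mul_assoc] using h

/-- A sum over `ℤ^d` splits as a sum over residue classes modulo `q`. -/
theorem tsum_pi_int_eq_sum_residues {d : Type*} [Fintype d] [DecidableEq d] (q : ℕ) [NeZero q]
    {h : (d → ℤ) → ℂ}
    (hs : ∀ a : d → Fin q, Summable fun k : d → ℤ => ‖h fun i => k i * q + ((a i : ℕ) : ℤ)‖) :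
    ∑' k, h k = ∑ a : d → Fin q, ∑' k : d → ℤ, h fun i => k i * q + ((a i : ℕ) : ℤ) := by
  let e : (d → Fin q) × (d → ℤ) ≃ (d → ℤ) :=
    (Equiv.prodComm _ _).trans ((Equiv.arrowProdEquivProdArrow d _ _).symm.trans
      (Equiv.piCongrRight fun _ => (Int.divModEquiv q).symm))
  have he : ∀ a k, e (a, k) = fun i => k i * q + ((a i : ℕ) : ℤ) := fun _ _ => rfl
  have hsum : Summable fun p => h (e p) := by
    refine Summable.of_norm ((summable_prod_of_nonneg fun _ => norm_nonneg _).2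
      ⟨fun a => by simpa only [he] using hs a, Summable.of_finite⟩)
  rw [← e.tsum_eq h, hsum.tsum_prod, tsum_fintype]
  rfl

/-- A function on `ℤ^d` with period `q` in each coordinate is invariant under `q ℤ^d`. -/
theorem apply_mul_add_of_forall_single {d α : Type*} [Fintype d] [DecidableEq d] {q : ℤ}
    {c : (d → ℤ) → α} (hc : ∀ (a : d → ℤ) (j : d), c (a + Pi.single j q) = c a)
    (k a : d → ℤ) : c (fun i => k i * q + a i) = c a := by
  let H : AddSubgroup (d → ℤ) :=
    { carrier := {v | ∀ a, c (a + v) = c a}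
      zero_mem' := fun a => by rw [add_zero]
      add_mem' := fun {v w} hv hw a => by rw [← add_assoc, hw, hv]
      neg_mem' := fun {v} hv a => by rw [← hv (a + -v), neg_add_cancel_right] }
  have hmem : ∑ j, k j • (Pi.single j q : d → ℤ) ∈ H :=
    H.sum_mem fun j _ => H.zsmul_mem (fun a => hc a j) _
  rw [← hmem a]
  congr 1
  ext i
  simp [Finset.sum_apply, Pi.single_apply, add_comm]

/-- the twisted Poisson summation formula. Let `q ≥ 1` and let
`c : ℤ^n → ℂ` be `q`-periodic in each coordinate, with discrete Fourier transform
`ĉ(m) = Σ_{a∈(ℤ/qℤ)^n} c(a) e^{2πi⟨a/q, m⟩}`. Let `Γ = ℤ^n A` be a lattice and let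
`f : ℝ^n → ℂ` be `L¹` with (i) `Σ_{γ∈Γ} f(x+γ)` absolutely convergent and continuous
in `x`, and (ii) `Σ_{γ*∈Γ*} f̂(γ*)` absolutely convergent. Then for all `x ∈ ℝ^n`:
`Σ_{γ∈Γ} c(γA⁻¹) f(x+γ/q) = (1/|det A|) Σ_{γ*∈Γ*} ĉ(γ* ᵗA) f̂(γ*) e^{2πi⟨x,γ*⟩}`,
where `γ = k ᵥ* A`, `γA⁻¹ = k` and `γ* = m ᵥ* (Aᵀ)⁻¹`, `γ* ᵗA = m` for `k, m ∈ ℤ^n`. -/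
theorem twisted_poisson_summation_formula (n q : ℕ) (hq : 0 < q)
    (c : (Fin n → ℤ) → ℂ)
    (hc : ∀ (a : Fin n → ℤ) (j : Fin n), c (a + Pi.single j (q : ℤ)) = c a)
    (A : Matrix (Fin n) (Fin n) ℝ) (hA : IsUnit A.det)
    (f : (Fin n → ℝ) → ℂ) (hf : Integrable f)
    (hi : (∀ x : Fin n → ℝ, Summable fun k : Fin n → ℤ =>
            ‖f (x + (fun i => (k i : ℝ)) ᵥ* A)‖) ∧
          Continuous fun x : Fin n → ℝ => ∑' k : Fin n → ℤ, f (x + (fun i => (k i : ℝ)) ᵥ* A))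
    (hii : Summable fun m : Fin n → ℤ =>
            ‖∫ z : Fin n → ℝ, f z * Complex.exp (-(2 * Real.pi * I *
              ∑ j, (z j : ℂ) * (((fun i => (m i : ℝ)) ᵥ* (Aᵀ)⁻¹) j : ℂ)))‖) :
    ∀ x : Fin n → ℝ,
      ∑' k : Fin n → ℤ, c k * f (x + (q : ℝ)⁻¹ • ((fun i => (k i : ℝ)) ᵥ* A)) =
        ((|A.det| : ℝ) : ℂ)⁻¹ *
          ∑' m : Fin n → ℤ,
            (∑ a : Fin n → Fin q, c (fun i => ((a i : ℕ) : ℤ)) *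
              Complex.exp (2 * Real.pi * I *
                ∑ j, (((a j : ℕ) : ℝ) / (q : ℝ) * ((m j : ℝ)) : ℝ))) *
            (∫ z : Fin n → ℝ, f z * Complex.exp (-(2 * Real.pi * I *
              ∑ j, (z j : ℂ) * (((fun i => (m i : ℝ)) ᵥ* (Aᵀ)⁻¹) j : ℂ)))) *
            Complex.exp (2 * Real.pi * I *
              ∑ j, (x j : ℂ) * (((fun i => (m i : ℝ)) ᵥ* (Aᵀ)⁻¹) j : ℂ)) := by
  intro x
  have : NeZero q := ⟨hq.ne'⟩
  have hq0 : (q : ℝ) ≠ 0 := Nat.cast_ne_zero.2 hq.ne'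
  have hshift : ∀ (a : Fin n → Fin q) (k : Fin n → ℤ),
      c (fun i => k i * q + ((a i : ℕ) : ℤ)) *
          f (x + (q : ℝ)⁻¹ • ((fun i => ((k i * q + ((a i : ℕ) : ℤ) : ℤ) : ℝ)) ᵥ* A)) =
        c (fun i => ((a i : ℕ) : ℤ)) *
          f (x + (fun i => ((a i : ℕ) : ℝ) / (q : ℝ)) ᵥ* A + (fun i => (k i : ℝ)) ᵥ* A) := by
    intro a k
    rw [apply_mul_add_of_forall_single hc, add_assoc, ← Matrix.add_vecMul, ← Matrix.smul_vecMul]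
    congr 4
    ext i
    simp only [Pi.smul_apply, Pi.add_apply, smul_eq_mul]
    push_cast
    field_simp
    ring
  rw [tsum_pi_int_eq_sum_residues q fun a => by
    simpa only [hshift, norm_mul] using (hi.1 _).mul_left _]
  simp only [hshift, tsum_mul_left]
  have key : HasSum _ _ := hasSum_sum fun (a : Fin n → Fin q) (_ : a ∈ Finset.univ) =>
    (hasSum_poisson_lattice hA hf hi.2 hii.of_norm
      (x + (fun i => ((a i : ℕ) : ℝ) / (q : ℝ)) ᵥ* A)).mul_left (c fun i => ((a i : ℕ) : ℤ))
  rw [← key.tsum_eq, ← tsum_mul_left]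
  refine tsum_congr fun m => ?_
  rw [Finset.sum_mul, Finset.sum_mul, Finset.mul_sum]
  refine Finset.sum_congr rfl fun a _ => ?_
  have hexp : Complex.exp (2 * Real.pi * I *
        ∑ j, ((x + (fun i => ((a i : ℕ) : ℝ) / (q : ℝ)) ᵥ* A) j : ℂ) *
          (((fun i => (m i : ℝ)) ᵥ* (Aᵀ)⁻¹) j : ℂ)) =
      Complex.exp (2 * Real.pi * I * ∑ j, (((a j : ℕ) : ℝ) / (q : ℝ) * ((m j : ℝ)) : ℝ)) *
        Complex.exp (2 * Real.pi * I *
          ∑ j, (x j : ℂ) * (((fun i => (m i : ℝ)) ᵥ* (Aᵀ)⁻¹) j : ℂ)) := by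
    rw [← Complex.exp_add, ← mul_add]
    congr 2
    simp only [Pi.add_apply, Complex.ofReal_add, add_mul, Finset.sum_add_distrib,
      sum_vecMul_mul_vecMul_transpose_inv hA]
    rw [add_comm]
    push_cast
    rfl
  rw [hexp]
  ring
end
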